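/- arXiv:2102.00216 — 2 statements merged into one kernel-verified Lean document; each statement's English description precedes it below -/
import Mathlib

section
/- Fix an integer n ≥ 1, a radius R > 0, and constants λ₁ ≤ 0, λ₂ > 0, b ≤ 0 and 1 < p < 2. Then there exists a constant C > 0, depending only on n, R and p (not on the solution, nor on λ₁, λ₂ or b), such that every smooth positive solution u of Δu + λ₁ u ln u + λ₂ u^{b+1} = 0 on the ball B_{2R} ⊂ ℝⁿ satisfies |∇u|²/u² + p λ₁ ln u + λ₂ u^{b} ≤ C at every point of B_R. -/
open Real Metric
open scoped RealInnerProductSpace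

/-- The Euclidean Laplacian: trace of the Hessian. -/
noncomputable def lap {n : ℕ} (f : EuclideanSpace ℝ (Fin n) → ℝ)
    (x : EuclideanSpace ℝ (Fin n)) : ℝ :=
  ∑ i : Fin n,
    fderiv ℝ (fun y => fderiv ℝ f y (EuclideanSpace.single i 1)) x
      (EuclideanSpace.single i 1)

lemma profile_inequality {τ t : ℝ} (hτ : 0 < τ) (hτ1 : τ ≤ 1 / 64) (ht : τ ≤ t) :
    64 * τ ^ 4 * (t + τ) + τ ^ 2 / t
        + (64 * τ ^ 4 * (t + τ) + τ) * (64 * τ ^ 4 + τ / (2 * t))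
      ≤ τ * (t + τ) / (4 * t ^ 3)
        + 64 * τ * (64 * τ ^ 4 * (t + τ) + τ) ^ 2 * (t - τ) := by
  have ht0 : 0 < t := hτ.trans_le ht
  set X := 64 * τ ^ 4 * (t + τ) with hX
  have hX0 : 0 ≤ X := by positivity
  have hX1 : X ≤ 128 * τ ^ 4 * t := by
    have : 64 * τ ^ 4 * (t + τ) ≤ 64 * τ ^ 4 * (t + t) := by gcongr
    linarith
  rcases le_total (τ * t) (1 / 16) with h | h
  · have h0 : 0 < τ * t := by positivity
    have e1 : τ ^ 2 / t ≤ τ / (16 * t ^ 2) := by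
      rw [div_le_div_iff₀ ht0 (by positivity)]
      nlinarith [mul_le_mul_of_nonneg_left h h0.le]
    have h3 : (τ * t) ^ 3 ≤ (1 / 16) ^ 3 := by gcongr
    have e2 : 128 * τ ^ 4 * t ≤ τ / (32 * t ^ 2) := by
      rw [le_div_iff₀ (by positivity)]
      nlinarith
    have e3 : X ≤ τ := by
      refine hX1.trans ?_
      have : τ ^ 3 * (τ * t) ≤ (τ * (1 / 64) ^ 2) * (1 / 16) := by
        have : τ ^ 3 ≤ τ * (1 / 64) ^ 2 := by
          have : τ ^ 2 ≤ (1 / 64) ^ 2 := by gcongr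
          nlinarith
        gcongr
      nlinarith
    have e4 : (X + τ) * (64 * τ ^ 4 + τ / (2 * t)) ≤ (2 * τ) * (64 * τ ^ 4 + τ / (2 * t)) := by
      gcongr; linarith
    have e5 : (2 * τ) * (64 * τ ^ 4 + τ / (2 * t)) = 128 * τ ^ 4 * τ + τ ^ 2 / t := by
      field_simp; ring
    have e6 : 128 * τ ^ 4 * τ ≤ 128 * τ ^ 4 * t := by gcongr
    have e7 : τ / (4 * t ^ 2) ≤ τ * (t + τ) / (4 * t ^ 3) := by
      rw [div_le_div_iff₀ (by positivity) (by positivity)]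
      nlinarith [show 0 < τ ^ 2 * t ^ 2 by positivity]
    have e8 : 0 ≤ 64 * τ * (X + τ) ^ 2 * (t - τ) := by
      have : 0 ≤ t - τ := by linarith
      positivity
    have e9 : τ / (16 * t ^ 2) = (τ / t ^ 2) / 16 := by field_simp
    have e10 : τ / (32 * t ^ 2) = (τ / t ^ 2) / 32 := by field_simp
    have e11 : τ / (4 * t ^ 2) = (τ / t ^ 2) / 4 := by field_simp
    have e12 : 0 ≤ τ / t ^ 2 := by positivity
    linarith
  · have ht4 : 4 ≤ t := by nlinarith
    have e1 : τ ^ 2 / t ≤ τ ^ 2 := div_le_self (by positivity) (by linarith)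
    have e2 : τ / (2 * t) ≤ τ / 8 := by gcongr; linarith
    have e3 : 64 * τ ^ 4 ≤ τ / 8 := by
      have : τ ^ 3 ≤ (1 / 64) ^ 3 := by gcongr
      nlinarith
    have e4 : (X + τ) * (64 * τ ^ 4 + τ / (2 * t)) ≤ (X + τ) * ((X + τ) / 4) := by
      gcongr; linarith
    have e5 : 128 * τ ^ 4 * t ≤ 2 * τ ^ 3 * t := by
      have : 0 < τ ^ 3 * t := by positivity
      nlinarith
    have e6 : 32 * (τ * t) * (X + τ) ^ 2 ≤ 64 * τ * (X + τ) ^ 2 * (t - τ) := by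
      have h1 : 0 ≤ (t - 2 * τ) := by linarith
      have : 0 ≤ 32 * τ * (X + τ) ^ 2 * (t - 2 * τ) := by positivity
      linarith
    have e7 : τ ^ 2 ≤ (X + τ) ^ 2 := by gcongr; linarith
    have e8 : 16 * (τ * t) * τ ^ 2 ≤ 16 * (τ * t) * (X + τ) ^ 2 := by gcongr
    have e9 : 16 * (1 / 16) * (X + τ) ^ 2 ≤ 16 * (τ * t) * (X + τ) ^ 2 := by gcongr
    have e10 : 1 / 16 * τ ^ 2 ≤ (τ * t) * τ ^ 2 := by gcongr
    have e11 : 0 ≤ τ * (t + τ) / (4 * t ^ 3) := by positivity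
    nlinarith

/-- A concave perturbation of the identity, vanishing at `0`, with slope at most `p`. -/
lemma exists_profile {N p : ℝ} (hN : 1 ≤ N) (hp1 : 1 < p) (hp2 : p < 2) :
    ∃ δ : ℝ, 0 < δ ∧ δ ≤ 1 ∧ ∃ g g₁ g₂ : ℝ → ℝ, Continuous g ∧ g 0 = 0 ∧ ∀ s, 0 < s →
      HasDerivAt g (g₁ s) s ∧ HasDerivAt g₁ (g₂ s) s ∧ (1 + δ) * s ≤ g s ∧ g s ≤ p * s ∧
      0 ≤ g₁ s ∧ 2 * (g₁ s - 1) + g₂ s ≤ g₁ s ∧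
      (2 * (g₁ s - 1) + g₂ s) * g s ≤ g₁ s * (g s - s) + (g s - s) ^ 2 / N := by
  obtain ⟨q, hq⟩ : ∃ q, q = p - 1 := ⟨_, rfl⟩
  have hq0 : 0 < q := by linarith
  have hq1 : q < 1 := by linarith
  obtain ⟨τ, hτ⟩ : ∃ τ, τ = q / (64 * N) := ⟨_, rfl⟩
  have hN0 : 0 < N := by linarith
  have hτ0 : 0 < τ := by rw [hτ]; positivity
  have hτ1 : τ ≤ 1 / 64 := by
    rw [hτ, div_le_div_iff₀ (by positivity) (by norm_num)]; nlinarith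
  have hβ : 64 * τ ^ 4 ≤ 1 / 2 := by
    have : τ ^ 4 ≤ (1 / 64) ^ 4 := by gcongr
    nlinarith
  refine ⟨q * (64 * τ ^ 4), by positivity, by nlinarith [show 0 < τ ^ 4 by positivity],
    fun s => (1 + q * (64 * τ ^ 4)) * s + q * τ * (√(s + τ ^ 2) - τ),
    fun s => 1 + q * (64 * τ ^ 4) + q * τ * (1 / (2 * √(s + τ ^ 2))),
    fun s => q * τ * (- (1 / (4 * √(s + τ ^ 2) ^ 3))), by fun_prop, ?_, ?_⟩
  · simp [Real.sqrt_sq hτ0.le]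
  intro s hs
  obtain ⟨t, ht⟩ : ∃ t, t = √(s + τ ^ 2) := ⟨_, rfl⟩
  have ht0 : 0 < t := by rw [ht]; positivity
  have hts : t ^ 2 = s + τ ^ 2 := by rw [ht, Real.sq_sqrt (by positivity)]
  have htτ : τ < t := by nlinarith
  have hd : HasDerivAt (fun s => √(s + τ ^ 2)) (1 / (2 * t)) s := by
    rw [ht]
    exact ((hasDerivAt_id s).add_const (τ ^ 2)).sqrt (by simp; positivity)
  have key := profile_inequality hτ0 hτ1 htτ.le
  have hs' : s = (t - τ) * (t + τ) := by linarith
  have hqN : 1 / N = 64 * τ / q := by rw [hτ]; field_simp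
  simp only [← ht]
  refine ⟨?_, ?_, ?_, ?_, ?_, ?_, ?_⟩
  · have h := ((hasDerivAt_id s).const_mul (1 + q * (64 * τ ^ 4))).add
      ((hd.sub_const τ).const_mul (q * τ))
    exact (h.congr_deriv (by simp)).congr_of_eventuallyEq (.of_forall fun r => by simp)
  · have h := ((hd.const_mul 2).inv (by simp [← ht]; positivity)).const_mul (q * τ)
    have h' := h.const_add (1 + q * (64 * τ ^ 4))
    refine (h'.congr_deriv ?_).congr_of_eventuallyEq (.of_forall fun r => ?_)
    · simp only [← ht]; field_simp; ring
    · simp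
  · have : 0 ≤ q * τ * (t - τ) := by
      have : 0 ≤ t - τ := by linarith
      positivity
    linarith
  · have h1 : 64 * τ ^ 4 * s ≤ s / 2 := by nlinarith
    have h2 : τ * (t - τ) ≤ s / 2 := by rw [hs']; nlinarith
    have hp : p = 1 + q := by linarith
    rw [hp]
    nlinarith
  · positivity
  · have h1 : τ * (1 / (2 * t)) ≤ 1 / 2 := by
      rw [mul_one_div, div_le_div_iff₀ (by positivity) (by norm_num)]; linarith
    have h2 : 0 ≤ q * τ * (1 / (4 * t ^ 3)) := by positivity
    nlinarith
  · obtain ⟨ε, hε⟩ : ∃ ε, ε = 64 * τ ^ 4 * (t + τ) + τ := ⟨_, rfl⟩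
    have hε0 : 0 < ε := by rw [hε]; positivity
    have he : (1 + q * (64 * τ ^ 4)) * s + q * τ * (t - τ) = s + q * ((t - τ) * ε) := by
      rw [hs', hε]; ring
    rw [he]
    have hgap : 0 < t - τ := by linarith
    have key2 := mul_le_mul_of_nonneg_left key (show 0 ≤ q * (t - τ) by positivity)
    rw [← hε] at key2
    have hdiv : (s + q * ((t - τ) * ε) - s) ^ 2 / N = q * (t - τ) * (64 * τ * ε ^ 2 * (t - τ)) := by
      rw [div_eq_mul_one_div, hqN]; field_simp; ring
    rw [hdiv]
    have hc : q * (q * (t - τ) * (ε * (64 * τ ^ 4 + τ / (2 * t))))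
        ≤ q * (t - τ) * (ε * (64 * τ ^ 4 + τ / (2 * t))) := by
      apply mul_le_of_le_one_left _ hq1.le
      positivity
    have hneg : 0 ≤ q * τ * (1 / (4 * t ^ 3)) * (q * ((t - τ) * ε)) := by positivity
    have id1 : q * (t - τ) * (64 * τ ^ 4 * (t + τ) + τ ^ 2 / t
          - τ * (t + τ) / (4 * t ^ 3)) =
        (2 * (q * (64 * τ ^ 4) + q * τ * (1 / (2 * t))) + q * τ * -(1 / (4 * t ^ 3))) * s
        - q * (t - τ) * ε := by
      rw [hε, hs']; field_simp; ring
    have id2 : q * (q * (t - τ) * (ε * (64 * τ ^ 4 + τ / (2 * t)))) =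
      (q * (64 * τ ^ 4) + q * τ * (1 / (2 * t))) * (q * ((t - τ) * ε)) := by
      field_simp
    linarith

/-- `N` is the dimension, `S` the squared norm of the Hessian of `w = log u`, `G` the squared norm
of its gradient, `L` its Laplacian, and `γ, γ₁, γ₂` are the jet of the profile at `w`. -/
lemma bochner_lower_bound_of_pos {N δ p K b E G S w γ γ₁ γ₂ F L : ℝ} (hN : 1 ≤ N)
    (hδ : 0 < δ) (hδ1 : δ ≤ 1) (hp2 : p < 2) (hK : 0 ≤ K) (hb : b ≤ 0)
    (hE : 0 < E) (hG : 0 ≤ G) (hS : L ^ 2 ≤ N * S) (hw : 0 < w)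
    (hF : F = G + E - K * γ) (hF0 : 0 < F) (hL : L = -G + K * w - E)
    (h1 : (1 + δ) * w ≤ γ) (h2 : γ ≤ p * w) (h3 : 0 ≤ γ₁)
    (h4 : 2 * (γ₁ - 1) + γ₂ ≤ γ₁)
    (h5 : (2 * (γ₁ - 1) + γ₂) * γ ≤ γ₁ * (γ - w) + (γ - w) ^ 2 / N) :
    δ / (4 * N) * F * (F + G) ≤ 2 * S + 2 * K * G + b ^ 2 * E * G + b * E * L
      - K * (γ₂ * G + γ₁ * L) - 2 * K * γ₁ * G := by
  have hN0 : 0 < N := by linarith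
  obtain ⟨e, he⟩ : ∃ e, e = γ - w := ⟨_, rfl⟩
  obtain ⟨σ, hσ⟩ : ∃ σ, σ = 2 * (γ₁ - 1) + γ₂ := ⟨_, rfl⟩
  rw [← hσ] at h4 h5
  rw [← he] at h5
  have heδ : δ * w ≤ e := by rw [he]; linarith
  have he0 : 0 < e := lt_of_lt_of_le (by positivity) heδ
  have hLF : L = -(F + K * e) := by rw [hF, hL, he]; ring
  have hL0 : 0 ≤ -L := by rw [hLF]; nlinarith
  have hbE : 0 ≤ b ^ 2 * E * G + b * E * L := by
    have : 0 ≤ (-b) * E * (-L) := by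
      have : 0 ≤ -b := by linarith
      positivity
    have : 0 ≤ b ^ 2 * E * G := by positivity
    linarith
  have hS' : (F + K * e) ^ 2 / N ≤ S := by
    rw [div_le_iff₀ hN0]
    have : L ^ 2 = (F + K * e) ^ 2 := by rw [hLF]; ring
    linarith
  have hmain : -(K ^ 2 * (e ^ 2 / N)) ≤ -(K * σ * G) + K * γ₁ * (F + K * e) := by
    have hKe : 0 ≤ K * e := by positivity
    have hsq : 0 ≤ K ^ 2 * (e ^ 2 / N) := by positivity
    rcases le_total σ 0 with h | h
    · have h6 : 0 ≤ K * (-σ) * G := by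
        have : 0 ≤ -σ := by linarith
        positivity
      have h7 : 0 ≤ K * γ₁ * (F + K * e) := by positivity
      linarith
    · have hGle : G ≤ F + K * γ := by linarith
      have h6 : K * σ * G ≤ K * σ * (F + K * γ) := by gcongr
      have h7 : K ^ 2 * (σ * γ) ≤ K ^ 2 * (γ₁ * e + e ^ 2 / N) := by gcongr
      have h8 : K * F * σ ≤ K * F * γ₁ := by gcongr
      linarith
  have hquad : (F ^ 2 + 2 * F * (K * e)) / N ≤
      2 * ((F + K * e) ^ 2 / N) - K ^ 2 * (e ^ 2 / N) := by
    have : 2 * ((F + K * e) ^ 2 / N) - K ^ 2 * (e ^ 2 / N)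
        - (F ^ 2 + 2 * F * (K * e)) / N = (F ^ 2 + 2 * F * (K * e) + (K * e) ^ 2) / N := by
      field_simp; ring
    have : 0 ≤ (F ^ 2 + 2 * F * (K * e) + (K * e) ^ 2) / N := by positivity
    linarith
  have hfin : δ / (4 * N) * F * (F + G) ≤ (F ^ 2 + 2 * F * (K * e)) / N := by
    have h6 : δ / (4 * N) * F * (F + G) = F * (δ / 4 * (F + G)) / N := by field_simp
    have h7 : F ^ 2 + 2 * F * (K * e) = F * (F + 2 * (K * e)) := by ring
    rw [h6, h7]
    have hGle : F + G ≤ 2 * F + 2 * (K * w) := by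
      have h8 : K * γ ≤ K * (p * w) := by gcongr
      nlinarith [mul_nonneg hK hw.le]
    have h9 : δ / 4 * (F + G) ≤ δ / 4 * (2 * F + 2 * (K * w)) := by gcongr
    have h10 : δ * F ≤ 1 * F := by gcongr
    have h11 : K * (δ * w) ≤ K * e := by gcongr
    have h12 : 0 ≤ K * e := by positivity
    gcongr
    linarith
  have : K * (γ₂ * G + γ₁ * L) + 2 * K * γ₁ * G - 2 * K * G
      = K * σ * G - K * γ₁ * (F + K * e) := by rw [hσ, hLF]; ring
  linarith

lemma bochner_lower_bound_of_nonpos {N p K b E G S w F L : ℝ} (hN : 1 ≤ N)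
    (hp1 : 1 < p) (hp2 : p < 2) (hK : 0 ≤ K) (hb : b ≤ 0)
    (hE : 0 < E) (hG : 0 ≤ G) (hS : L ^ 2 ≤ N * S) (hw : w ≤ 0)
    (hF : F = G + E - K * (p * w)) (hF0 : 0 < F) (hL : L = -G + K * w - E) :
    1 / (4 * N) * F * (F + G) ≤ 2 * S + 2 * K * G + b ^ 2 * E * G + b * E * L
      - K * (0 * G + p * L) - 2 * K * p * G := by
  have hN0 : 0 < N := by linarith
  have hx : 0 ≤ K * (-w) := mul_nonneg hK (by linarith)
  obtain ⟨x, hxd⟩ : ∃ x, x = K * (-w) := ⟨_, rfl⟩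
  rw [← hxd] at hx
  have hF' : F = G + E + p * x := by rw [hF, hxd]; ring
  have hL' : -L = G + E + x := by rw [hL, hxd]; ring
  have hL2 : F / 2 ≤ -L := by
    rw [hL', hF']; nlinarith
  have hbE : 0 ≤ b ^ 2 * E * G + b * E * L := by
    have : 0 ≤ (-b) * E * (-L) := by
      have : 0 ≤ -b := by linarith
      have : 0 ≤ -L := by linarith
      positivity
    have : 0 ≤ b ^ 2 * E * G := by positivity
    linarith
  have hS' : (F / 2) ^ 2 / N ≤ S := by
    rw [div_le_iff₀ hN0]
    have : (F / 2) ^ 2 ≤ (-L) ^ 2 := by gcongr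
    linarith
  have hGF : G ≤ F := by nlinarith
  have hK' : 0 ≤ K * (2 * G - p * L - 2 * p * G) := by
    apply mul_nonneg hK
    nlinarith
  have hfin : 1 / (4 * N) * F * (F + G) ≤ 2 * ((F / 2) ^ 2 / N) := by
    have : 1 / (4 * N) * F * (F + G) ≤ 1 / (4 * N) * F * (F + F) := by gcongr
    refine this.trans (le_of_eq ?_)
    field_simp; ring
  linarith

/-- `f` is twice differentiable at `0` with second order jet `(a, a', a'')`. -/
def HasJet (f : ℝ → ℝ) (a a' a'' : ℝ) : Prop :=
  f 0 = a ∧ ∃ f' : ℝ → ℝ, f' 0 = a' ∧ (∀ᶠ t in nhds 0, HasDerivAt f (f' t) t) ∧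
    HasDerivAt f' a'' 0

namespace HasJet

variable {f g : ℝ → ℝ} {a a' a'' c c' c'' : ℝ}

lemma congr_jet {d d' d'' : ℝ} (hf : HasJet f a a' a'') (h : a = d) (h' : a' = d')
    (h'' : a'' = d'') : HasJet f d d' d'' := by
  subst h h' h''; exact hf

lemma hasDerivAt (hf : HasJet f a a' a'') : HasDerivAt f a' 0 := by
  obtain ⟨_, f', h0, h1, _⟩ := hf
  exact h0 ▸ h1.self_of_nhds

lemma add (hf : HasJet f a a' a'') (hg : HasJet g c c' c'') :
    HasJet (fun t => f t + g t) (a + c) (a' + c') (a'' + c'') := by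
  obtain ⟨rfl, f', rfl, h1, h2⟩ := hf
  obtain ⟨rfl, g', rfl, k1, k2⟩ := hg
  exact ⟨rfl, fun t => f' t + g' t, rfl, by filter_upwards [h1, k1] with t x y using x.add y,
    h2.add k2⟩

lemma mul (hf : HasJet f a a' a'') (hg : HasJet g c c' c'') :
    HasJet (fun t => f t * g t) (a * c) (a' * c + a * c') (a'' * c + 2 * a' * c' + a * c'') := by
  have hf0 := hf.hasDerivAt
  have hg0 := hg.hasDerivAt
  obtain ⟨rfl, f', rfl, h1, h2⟩ := hf
  obtain ⟨rfl, g', rfl, k1, k2⟩ := hg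
  refine ⟨rfl, fun t => f' t * g t + f t * g' t, rfl,
    by filter_upwards [h1, k1] with t x y using x.mul y, ?_⟩
  exact ((h2.mul hg0).add (hf0.mul k2)).congr_deriv (by ring)

lemma comp {φ φ₁ : ℝ → ℝ} {φ₂ : ℝ} (hf : HasJet f a a' a'')
    (h : ∀ᶠ s in nhds a, HasDerivAt φ (φ₁ s) s) (h' : HasDerivAt φ₁ φ₂ a) :
    HasJet (fun t => φ (f t)) (φ a) (φ₁ a * a') (φ₂ * a' ^ 2 + φ₁ a * a'') := by
  have hf0 := hf.hasDerivAt
  obtain ⟨rfl, f', rfl, h1, h2⟩ := hf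
  refine ⟨rfl, fun t => φ₁ (f t) * f' t, rfl, ?_, ?_⟩
  · filter_upwards [h1, hf0.continuousAt.eventually h] with t x y using y.comp t x
  · exact ((h'.comp 0 hf0).mul h2).congr_deriv (by simp; ring)

lemma const (a : ℝ) : HasJet (fun _ => a) a 0 0 :=
  ⟨rfl, fun _ => 0, rfl, .of_forall fun t => hasDerivAt_const t a, hasDerivAt_const _ _⟩

lemma sum {ι : Type*} (s : Finset ι) {f : ι → ℝ → ℝ} {a a' a'' : ι → ℝ}
    (hf : ∀ i ∈ s, HasJet (f i) (a i) (a' i) (a'' i)) :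
    HasJet (fun t => ∑ i ∈ s, f i t) (∑ i ∈ s, a i) (∑ i ∈ s, a' i) (∑ i ∈ s, a'' i) := by
  classical
  induction s using Finset.induction_on with
  | empty => simpa using const 0
  | insert i s hi ih =>
    simp only [Finset.sum_insert hi]
    exact (hf i (by simp)).add (ih fun j hj => hf j (by simp [hj]))

/-- The second derivative test at a local maximum. -/
lemma of_isLocalMax (hf : HasJet f a a' a'') (hm : IsLocalMax f 0) : a' = 0 ∧ a'' ≤ 0 := by
  have hf0 := hf.hasDerivAt
  have ha' : a' = 0 := hm.hasDerivAt_eq_zero hf0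
  refine ⟨ha', ?_⟩
  by_contra! hpos
  obtain ⟨rfl, f', rfl, h1, h2⟩ := hf
  have hd : deriv f =ᶠ[nhds 0] f' := by filter_upwards [h1] with t ht using ht.deriv
  have hdd : deriv (deriv f) 0 = a'' := by rw [hd.deriv_eq, h2.deriv]
  have hmin := isLocalMin_of_deriv_deriv_pos (hdd ▸ hpos) (by rw [hf0.deriv, ha'])
    hf0.continuousAt
  have hconst : f =ᶠ[nhds 0] fun _ => f 0 := by
    filter_upwards [hm, hmin] with t x y using le_antisymm x y
  have h3 : deriv f =ᶠ[nhds 0] fun _ => 0 := by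
    simpa using hconst.deriv
  have h4 : deriv (deriv f) 0 = 0 := by rw [h3.deriv_eq]; simp
  linarith

end HasJet

section PartialDerivatives

variable {n : ℕ}

/-- The `i`-th partial derivative. -/
noncomputable def pd (i : Fin n) (f : EuclideanSpace ℝ (Fin n) → ℝ)
    (x : EuclideanSpace ℝ (Fin n)) : ℝ :=
  fderiv ℝ f x (EuclideanSpace.single i 1)

variable {f g : EuclideanSpace ℝ (Fin n) → ℝ} {x : EuclideanSpace ℝ (Fin n)}

lemma lap_eq_sum_pd : lap f x = ∑ i, pd i (pd i f) x := rfl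

lemma contDiffAt_pd (hf : ContDiffAt ℝ (⊤ : ℕ∞) f x) (i : Fin n) :
    ContDiffAt ℝ (⊤ : ℕ∞) (pd i f) x :=
  (hf.fderiv_right (m := (⊤ : ℕ∞)) (by norm_cast)).clm_apply contDiffAt_const

lemma contDiffAt_eventually (hf : ContDiffAt ℝ (⊤ : ℕ∞) f x) (m : ℕ) :
    ∀ᶠ y in nhds x, ContDiffAt ℝ m f y :=
  (hf.of_le (by exact_mod_cast le_top)).eventually (by simp)

lemma pd_congr (h : f =ᶠ[nhds x] g) (i : Fin n) : pd i f x = pd i g x := by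
  rw [pd, pd, h.fderiv_eq]

lemma eventuallyEq_pd (h : f =ᶠ[nhds x] g) (i : Fin n) : pd i f =ᶠ[nhds x] pd i g :=
  h.eventuallyEq_nhds.mono fun _ hy => pd_congr hy i

lemma pd_comm (hf : ContDiffAt ℝ 2 f x) (i j : Fin n) :
    pd i (pd j f) x = pd j (pd i f) x := by
  have hd : DifferentiableAt ℝ (fderiv ℝ f) x :=
    (hf.fderiv_right (m := 1) (by norm_num)).differentiableAt (by norm_num)
  have key : ∀ i j : Fin n, pd i (pd j f) x =
      fderiv ℝ (fderiv ℝ f) x (EuclideanSpace.single i 1) (EuclideanSpace.single j 1) := by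
    intro i j
    change fderiv ℝ (fun y => fderiv ℝ f y (EuclideanSpace.single j 1)) x _ = _
    rw [fderiv_clm_apply hd (differentiableAt_const _)]
    simp
  rw [key, key]
  exact (hf.isSymmSndFDerivAt (by simp)).eq _ _

lemma hasDerivAt_line (hf : DifferentiableAt ℝ f x) (i : Fin n) (t : ℝ)
    {y : EuclideanSpace ℝ (Fin n)} (hx : x = y + t • EuclideanSpace.single i 1) :
    HasDerivAt (fun t => f (y + t • EuclideanSpace.single i (1 : ℝ))) (pd i f x) t := by
  have h : HasDerivAt (fun t : ℝ => y + t • EuclideanSpace.single i (1 : ℝ))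
      (EuclideanSpace.single i (1 : ℝ)) t := by
    simpa using ((hasDerivAt_id t).smul_const (EuclideanSpace.single i (1 : ℝ))).const_add y
  subst hx
  exact hf.hasFDerivAt.comp_hasDerivAt t h

lemma tendsto_line (x : EuclideanSpace ℝ (Fin n)) (i : Fin n) :
    Filter.Tendsto (fun t : ℝ => x + t • EuclideanSpace.single i (1 : ℝ)) (nhds 0) (nhds x) := by
  have : Continuous (fun t : ℝ => x + t • EuclideanSpace.single i (1 : ℝ)) := by fun_prop
  simpa using this.tendsto 0

lemma hasJet_line (hf : ContDiffAt ℝ (⊤ : ℕ∞) f x) (i : Fin n) :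
    HasJet (fun t => f (x + t • EuclideanSpace.single i (1 : ℝ)))
      (f x) (pd i f x) (pd i (pd i f) x) := by
  refine ⟨by simp, fun t => pd i f (x + t • EuclideanSpace.single i (1 : ℝ)), by simp, ?_, ?_⟩
  · filter_upwards [(tendsto_line x i).eventually (contDiffAt_eventually hf 1)] with t ht
    exact hasDerivAt_line (ht.differentiableAt (by norm_num)) i t rfl
  · exact hasDerivAt_line ((contDiffAt_pd hf i).differentiableAt (by simp)) i 0 (by simp)

lemma HasJet.pd_eq {a a' a'' : ℝ} {i : Fin n} (hf : DifferentiableAt ℝ f x)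
    (h : HasJet (fun t => f (x + t • EuclideanSpace.single i (1 : ℝ))) a a' a'') :
    pd i f x = a' :=
  (hasDerivAt_line hf i 0 (by simp)).unique h.hasDerivAt

lemma HasJet.pd_pd_eq {a a' a'' : ℝ} {i : Fin n} (hf : ContDiffAt ℝ (⊤ : ℕ∞) f x)
    (h : HasJet (fun t => f (x + t • EuclideanSpace.single i (1 : ℝ))) a a' a'') :
    pd i (pd i f) x = a'' := by
  obtain ⟨-, f', -, h1, h2⟩ := h
  have h3 := hasDerivAt_line ((contDiffAt_pd hf i).differentiableAt (by simp)) i 0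
    (show x = x + (0 : ℝ) • _ by simp)
  refine h3.unique (h2.congr_of_eventuallyEq ?_)
  filter_upwards [(tendsto_line x i).eventually (contDiffAt_eventually hf 1), h1] with t ht h1
  exact (hasDerivAt_line (ht.differentiableAt (by norm_num)) i t rfl).unique h1

lemma norm_gradient_sq :
    ‖gradient f x‖ ^ 2 = ∑ i, pd i f x ^ 2 := by
  rw [EuclideanSpace.norm_sq_eq]
  refine Finset.sum_congr rfl fun i _ => ?_
  have : pd i f x = gradient f x i := by
    rw [pd, gradient, ← InnerProductSpace.toDual_symm_apply, EuclideanSpace.inner_single_right]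
    simp
  rw [this, Real.norm_eq_abs, sq_abs]

/-- The Laplacian commutes with partial derivatives. -/
lemma sum_pd_pd_pd (hf : ContDiffAt ℝ (⊤ : ℕ∞) f x) (j : Fin n) :
    ∑ i, pd i (pd i (pd j f)) x = pd j (fun y => ∑ i, pd i (pd i f) y) x := by
  have h1 : pd j (fun y => ∑ i, pd i (pd i f) y) x = ∑ i, pd j (pd i (pd i f)) x := by
    have h : HasFDerivAt (fun y => ∑ i, pd i (pd i f) y)
        (∑ i, fderiv ℝ (pd i (pd i f)) x) x := by
      refine HasFDerivAt.fun_sum fun i _ => ?_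
      exact ((contDiffAt_pd (contDiffAt_pd hf i) i).differentiableAt (by simp)).hasFDerivAt
    rw [pd, h.fderiv]
    simp [pd]
  rw [h1]
  refine Finset.sum_congr rfl fun i _ => ?_
  have h2 : pd i (pd j f) =ᶠ[nhds x] pd j (pd i f) :=
    (contDiffAt_eventually hf 2).mono fun y hy => pd_comm (by exact_mod_cast hy) i j
  rw [pd_congr h2, pd_comm (by exact_mod_cast (contDiffAt_eventually (contDiffAt_pd hf i) 2).self_of_nhds)]

end PartialDerivatives

section MaximumPrinciple

variable {n : ℕ}

lemma bochner_maximum_algebra {W X F₁ F₂ : Fin n → ℝ} {H T : Fin n → Fin n → ℝ}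
    {φ F K b E γ₁ γ₂ : ℝ} (hφ : 0 < φ)
    (hT : ∀ j, ∑ i, T i j = -(∑ i, 2 * (W i * H j i)) + K * W j - E * (b * W j))
    (hF₁ : ∀ i, F₁ i = (∑ j, 2 * (W j * H i j)) + E * (b * W i) - K * (γ₁ * W i))
    (hF₂ : ∀ i, F₂ i = (∑ j, 2 * (H i j ^ 2 + W j * T i j)) + E * (b ^ 2 * W i ^ 2 + b * H i i)
      - K * (γ₂ * W i ^ 2 + γ₁ * H i i))
    (h₁ : ∀ i, -4 * φ * X i * F + φ ^ 2 * F₁ i = 0)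
    (h₂ : ∀ i, (8 * X i ^ 2 - 4 * φ) * F + 2 * (-4 * φ * X i) * F₁ i + φ ^ 2 * F₂ i ≤ 0) :
    φ ^ 2 * (2 * (∑ i, ∑ j, H i j ^ 2) + 2 * K * (∑ i, W i ^ 2) + b ^ 2 * E * (∑ i, W i ^ 2)
        + b * E * (∑ i, H i i) - K * (γ₂ * (∑ i, W i ^ 2) + γ₁ * (∑ i, H i i))
        - 2 * K * γ₁ * (∑ i, W i ^ 2))
      ≤ F * (24 * (∑ i, X i ^ 2) + 4 * n * φ + 8 * φ * (∑ i, W i * X i)) := by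
  have hgrad : ∀ i, φ * F₁ i = 4 * X i * F := fun i =>
    mul_left_cancel₀ hφ.ne' (by linarith [h₁ i])
  have hsum := Finset.sum_nonpos fun i (_ : i ∈ Finset.univ) => h₂ i
  have e1 : ∑ i, ((8 * X i ^ 2 - 4 * φ) * F + 2 * (-4 * φ * X i) * F₁ i + φ ^ 2 * F₂ i)
      = -24 * F * (∑ i, X i ^ 2) - 4 * n * φ * F + φ ^ 2 * ∑ i, F₂ i := by
    have : ∀ i, (8 * X i ^ 2 - 4 * φ) * F + 2 * (-4 * φ * X i) * F₁ i + φ ^ 2 * F₂ i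
        = -24 * F * X i ^ 2 - 4 * φ * F + φ ^ 2 * F₂ i := fun i => by
      linear_combination (-8 * X i) * hgrad i
    simp only [this, Finset.sum_add_distrib, Finset.sum_sub_distrib, ← Finset.mul_sum]
    simp
    ring
  have e2 : φ * ∑ i, W i * F₁ i = 4 * F * ∑ i, W i * X i := by
    rw [Finset.mul_sum, Finset.mul_sum]
    exact Finset.sum_congr rfl fun i _ => by linear_combination W i * hgrad i
  obtain ⟨M, hM⟩ : ∃ M, M = ∑ i, W i * ∑ j, W j * H i j := ⟨_, rfl⟩
  have e3 : ∑ i, W i * F₁ i = 2 * M + E * b * (∑ i, W i ^ 2) - K * γ₁ * (∑ i, W i ^ 2) := by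
    rw [hM]
    simp only [hF₁, Finset.mul_sum, ← Finset.sum_add_distrib, ← Finset.sum_sub_distrib]
    refine Finset.sum_congr rfl fun i _ => ?_
    have : W i * ∑ j, 2 * (W j * H i j) = ∑ j, 2 * (W i * (W j * H i j)) := by
      rw [Finset.mul_sum]; exact Finset.sum_congr rfl fun j _ => by ring
    rw [← this, ← Finset.mul_sum]; ring
  have e4 : ∑ i, ∑ j, 2 * (W j * T i j) = -4 * M + 2 * (K - E * b) * ∑ i, W i ^ 2 := by
    rw [Finset.sum_comm, hM, Finset.mul_sum, Finset.mul_sum, ← Finset.sum_add_distrib]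
    refine Finset.sum_congr rfl fun j _ => ?_
    have : ∑ i, 2 * (W j * T i j) = 2 * W j * ∑ i, T i j := by
      rw [Finset.mul_sum]; exact Finset.sum_congr rfl fun i _ => by ring
    rw [this, hT, ← Finset.mul_sum]; ring
  have e5 : ∑ i, F₂ i = 2 * (∑ i, ∑ j, H i j ^ 2) + (∑ i, ∑ j, 2 * (W j * T i j))
      + E * b ^ 2 * (∑ i, W i ^ 2) + E * b * (∑ i, H i i)
      - K * γ₂ * (∑ i, W i ^ 2) - K * γ₁ * (∑ i, H i i) := by
    simp only [hF₂, mul_add, Finset.sum_add_distrib, Finset.sum_sub_distrib, Finset.mul_sum,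
      mul_assoc]
    ring
  rw [e1, e5, e4] at hsum
  rw [e3] at e2
  linear_combination hsum + 2 * φ * e2

lemma hasJet_coord (x : EuclideanSpace ℝ (Fin n)) (i j : Fin n) :
    HasJet (fun t => (x + t • EuclideanSpace.single i (1 : ℝ)) j) (x j)
      (if j = i then 1 else 0) 0 := by
  refine ⟨by simp, fun _ => if j = i then 1 else 0, rfl, .of_forall fun t => ?_,
    hasDerivAt_const _ _⟩
  have := ((hasDerivAt_id t).mul_const (if j = i then (1 : ℝ) else 0)).const_add (x j)
  simpa [Pi.single_apply] using this

lemma hasJet_cutoff (r : ℝ) (x : EuclideanSpace ℝ (Fin n)) (i : Fin n) :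
    HasJet (fun t => (r - ∑ j, (x + t • EuclideanSpace.single i (1 : ℝ)) j ^ 2) ^ 2)
      ((r - ∑ j, x j ^ 2) ^ 2) (-4 * (r - ∑ j, x j ^ 2) * x i)
      (8 * x i ^ 2 - 4 * (r - ∑ j, x j ^ 2)) := by
  have h1 := HasJet.sum Finset.univ fun j _ => (hasJet_coord x i j).mul (hasJet_coord x i j)
  have h2 := (HasJet.const r).add ((HasJet.const (-1)).mul h1)
  have h3 := h2.mul h2
  convert h3.congr_jet (d := (r - ∑ j, x j ^ 2) ^ 2) (d' := -4 * (r - ∑ j, x j ^ 2) * x i)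
    (d'' := 8 * x i ^ 2 - 4 * (r - ∑ j, x j ^ 2)) ?_ ?_ ?_ using 1
  · ext t; simp only [← pow_two]; ring
  · simp only [← pow_two]; ring
  · simp [← pow_two, Finset.sum_add_distrib]; ring
  · simp [← pow_two, Finset.sum_add_distrib]; ring

lemma hasDerivAt_mul_exp (l b s : ℝ) :
    HasDerivAt (fun s => l * rexp (b * s)) (l * (b * rexp (b * s))) s := by
  have h : HasDerivAt (fun s => b * s) b s := by simpa using (hasDerivAt_id s).const_mul b
  exact (h.exp.const_mul l).congr_deriv (by ring)

lemma HasJet.mul_exp {f : ℝ → ℝ} {a a' a'' : ℝ} (hf : HasJet f a a' a'') (l b : ℝ) :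
    HasJet (fun t => l * rexp (b * f t)) (l * rexp (b * a)) (l * rexp (b * a) * (b * a'))
      (l * rexp (b * a) * (b ^ 2 * a' ^ 2 + b * a'')) := by
  refine (hf.comp (φ₁ := fun s => l * (b * rexp (b * s)))
    (φ₂ := l * (b * (b * rexp (b * a)))) (.of_forall fun s => hasDerivAt_mul_exp l b s) ?_).congr_jet
    rfl (by ring) (by ring)
  refine ((hasDerivAt_mul_exp b b a).const_mul l)

/-- The Bochner inequality at an interior maximum of the localized test function. -/
lemma bochner_at_isLocalMax {w : EuclideanSpace ℝ (Fin n) → ℝ} {x : EuclideanSpace ℝ (Fin n)}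
    {K b l r γ₂ : ℝ} {g g₁ : ℝ → ℝ}
    (hw : ContDiffAt ℝ (⊤ : ℕ∞) w x)
    (hpde : ∀ᶠ y in nhds x, ∑ i, pd i (pd i w) y
      = -(∑ i, pd i w y ^ 2) + K * w y - l * rexp (b * w y))
    (hg : ∀ᶠ s in nhds (w x), HasDerivAt g (g₁ s) s) (hg₁ : HasDerivAt g₁ γ₂ (w x))
    (hφ : 0 < r - ∑ i, x i ^ 2)
    (hmax : IsLocalMax (fun y : EuclideanSpace ℝ (Fin n) => (r - ∑ i, y i ^ 2) ^ 2 *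
      (∑ i, pd i w y ^ 2 + l * rexp (b * w y) - K * g (w y))) x) :
    (r - ∑ i, x i ^ 2) ^ 2 * (2 * (∑ i, ∑ j, pd i (pd j w) x ^ 2)
        + 2 * K * (∑ i, pd i w x ^ 2) + b ^ 2 * (l * rexp (b * w x)) * (∑ i, pd i w x ^ 2)
        + b * (l * rexp (b * w x)) * (∑ i, pd i (pd i w) x)
        - K * (γ₂ * (∑ i, pd i w x ^ 2) + g₁ (w x) * (∑ i, pd i (pd i w) x))
        - 2 * K * g₁ (w x) * (∑ i, pd i w x ^ 2))
      ≤ (∑ i, pd i w x ^ 2 + l * rexp (b * w x) - K * g (w x)) * (24 * (∑ i, x i ^ 2)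
        + 4 * n * (r - ∑ i, x i ^ 2)
        + 8 * (r - ∑ i, x i ^ 2) * (∑ i, pd i w x * x i)) := by
  have jw := fun i => hasJet_line hw i
  have jdw := fun i j => hasJet_line (contDiffAt_pd hw j) i
  have jG : ∀ i, HasJet (fun t => ∑ j, pd j w (x + t • EuclideanSpace.single i (1 : ℝ)) ^ 2)
      (∑ j, pd j w x ^ 2) (∑ j, 2 * (pd j w x * pd i (pd j w) x))
      (∑ j, 2 * (pd i (pd j w) x ^ 2 + pd j w x * pd i (pd i (pd j w)) x)) := by
    intro i
    refine HasJet.sum _ fun j _ => ?_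
    have h := ((jdw i j).mul (jdw i j)).congr_jet (pow_two _).symm
      (d' := 2 * (pd j w x * pd i (pd j w) x))
      (d'' := 2 * (pd i (pd j w) x ^ 2 + pd j w x * pd i (pd i (pd j w)) x)) (by ring) (by ring)
    simpa only [← pow_two] using h
  have jE := fun i => (jw i).mul_exp l b
  have jF := fun i => ((jG i).add (jE i)).add
    ((HasJet.const (-K)).mul ((jw i).comp hg hg₁))
  have hT : ∀ j, ∑ i, pd i (pd i (pd j w)) x = -(∑ i, 2 * (pd i w x * pd j (pd i w) x))
      + K * pd j w x - l * rexp (b * w x) * (b * pd j w x) := by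
    intro j
    rw [sum_pd_pd_pd hw]
    have hd : DifferentiableAt ℝ (fun y => ∑ i, pd i (pd i w) y) x :=
      DifferentiableAt.fun_sum fun i _ =>
        (contDiffAt_pd (contDiffAt_pd hw i) i).differentiableAt (by simp)
    rw [pd_congr hpde]
    have hj := (((HasJet.const (-1)).mul (jG j)).add ((HasJet.const K).mul (jw j))).add
      ((HasJet.const (-1)).mul (jE j))
    have hd' := (Filter.EventuallyEq.differentiableAt_iff hpde).mp hd
    refine HasJet.pd_eq hd' (a := -(∑ i, pd i w x ^ 2) + K * w x - l * rexp (b * w x)) (a'' := ?_) ?_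
    rotate_left
    · convert hj.congr_jet ?_ ?_ rfl using 1
      · ext t; ring
      · ring
      · ring
  have jQ := fun i => (hasJet_cutoff r x i).mul (jF i)
  have hQ : ∀ i, _ := fun i => (jQ i).of_isLocalMax (by
    have h := hmax
    filter_upwards [(tendsto_line x i).eventually h] with t ht
    simp only [zero_smul, add_zero]
    convert ht using 1 <;> ring)
  refine bochner_maximum_algebra (W := fun i => pd i w x) (X := fun i => x i)
    (H := fun i j => pd i (pd j w) x) (T := fun i j => pd i (pd i (pd j w)) x)
    (F₁ := fun i => _) (F₂ := fun i => _) hφ hT (fun i => rfl) (fun i => rfl) ?_ ?_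
  · intro i
    rw [← (hQ i).1]; ring
  · intro i
    refine le_of_eq_of_le ?_ (hQ i).2
    ring

end MaximumPrinciple

section GradientEstimate

variable {n : ℕ}

lemma sum_diag_sq_le (H : Fin n → Fin n → ℝ) :
    (∑ i, H i i) ^ 2 ≤ n * ∑ i, ∑ j, H i j ^ 2 := by
  have h1 : (∑ i, H i i) ^ 2 ≤ n * ∑ i, H i i ^ 2 := by
    simpa using sq_sum_le_card_mul_sum_sq (s := Finset.univ) (f := fun i => H i i)
  refine h1.trans ?_
  gcongr with i
  exact Finset.single_le_sum (f := fun j => H i j ^ 2) (fun j _ => sq_nonneg _)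
    (Finset.mem_univ i)

lemma sq_mul_le_of_bochner {W X : Fin n → ℝ} {c φ F r : ℝ} (hc : 0 < c) (hφ : 0 < φ)
    (hF : 0 < F) (hX : φ = r - ∑ i, X i ^ 2)
    (h : φ ^ 2 * (c * F * (F + ∑ i, W i ^ 2))
      ≤ F * (24 * (∑ i, X i ^ 2) + 4 * n * φ + 8 * φ * (∑ i, W i * X i))) :
    φ ^ 2 * F ≤ (24 * r + 4 * n * r + 16 * r / c) / c := by
  have h1 : φ ^ 2 * (c * (F + ∑ i, W i ^ 2))
      ≤ 24 * (∑ i, X i ^ 2) + 4 * n * φ + 8 * φ * (∑ i, W i * X i) :=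
    le_of_mul_le_mul_left (by linarith) hF
  have hX0 : 0 ≤ ∑ i, X i ^ 2 := Finset.sum_nonneg fun i _ => sq_nonneg _
  have h2 : 8 * φ * (∑ i, W i * X i)
      ≤ c * φ ^ 2 * (∑ i, W i ^ 2) + 16 / c * ∑ i, X i ^ 2 := by
    simp only [Finset.mul_sum, ← Finset.sum_add_distrib]
    refine Finset.sum_le_sum fun i _ => ?_
    have : 0 ≤ (c * φ * W i - 4 * X i) ^ 2 / c := by positivity
    have e : (c * φ * W i - 4 * X i) ^ 2 / c =
        c * φ ^ 2 * W i ^ 2 + 16 / c * X i ^ 2 - 8 * φ * (W i * X i) := by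
      field_simp; ring
    linarith
  have hXr : ∑ i, X i ^ 2 ≤ r := by linarith
  have hφr : φ ≤ r := by linarith
  have h3 : 16 / c * ∑ i, X i ^ 2 ≤ 16 / c * r := by gcongr
  have h4 : 4 * (n : ℝ) * φ ≤ 4 * n * r := by gcongr
  have h5 : 16 * r / c = 16 / c * r := by ring
  rw [le_div_iff₀ hc]
  linarith

lemma gradient_estimate_log (hn : 1 ≤ n) {R p : ℝ} (hR : 0 < R) (hp1 : 1 < p) (hp2 : p < 2) :
    ∃ C : ℝ, 0 < C ∧ ∀ (K l b : ℝ), 0 ≤ K → 0 < l → b ≤ 0 →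
      ∀ w : EuclideanSpace ℝ (Fin n) → ℝ,
        (∀ x ∈ ball (0 : EuclideanSpace ℝ (Fin n)) (2 * R), ContDiffAt ℝ (⊤ : ℕ∞) w x) →
        (∀ x ∈ ball (0 : EuclideanSpace ℝ (Fin n)) (2 * R), ∑ i, pd i (pd i w) x
          = -(∑ i, pd i w x ^ 2) + K * w x - l * rexp (b * w x)) →
        ∀ x ∈ ball (0 : EuclideanSpace ℝ (Fin n)) R,
          ∑ i, pd i w x ^ 2 + l * rexp (b * w x) - K * (p * w x) ≤ C := by
  have hN : (1 : ℝ) ≤ n := by exact_mod_cast hn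
  obtain ⟨δ, hδ, hδ1, g, g₁, g₂, hgc, hg0, hg⟩ := exists_profile hN hp1 hp2
  have hN0 : (0 : ℝ) < n := by linarith
  obtain ⟨c, hc⟩ : ∃ c, c = δ / (4 * n) := ⟨_, rfl⟩
  have hc0 : 0 < c := by rw [hc]; positivity
  obtain ⟨r, hr⟩ : ∃ r, r = (3 / 2 * R) ^ 2 := ⟨_, rfl⟩
  have hr0 : 0 < r := by rw [hr]; positivity
  obtain ⟨M, hM⟩ : ∃ M, M = (24 * r + 4 * n * r + 16 * r / c) / c := ⟨_, rfl⟩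
  have hM0 : 0 < M := by rw [hM]; positivity
  refine ⟨M / (5 / 4 * R ^ 2) ^ 2, by positivity, ?_⟩
  intro K l b hK hl hb w hw hpde
  obtain ⟨h, hh⟩ : ∃ h : ℝ → ℝ, h = fun s => if s ≤ 0 then p * s else g s := ⟨_, rfl⟩
  have hneg : ∀ s ≤ 0, h s = p * s := fun s hs => by simp [hh, hs]
  have hpos : ∀ s, 0 < s → h s = g s := fun s hs => by simp [hh, hs.not_ge]
  have hcont : Continuous h := by
    rw [hh]
    refine Continuous.if_le (by fun_prop) hgc continuous_id continuous_const ?_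
    intro s hs; rw [hs, hg0]; simp
  have hle : ∀ s, h s ≤ p * s := fun s => by
    rcases le_or_gt s 0 with hs | hs
    · rw [hneg s hs]
    · rw [hpos s hs]; exact (hg s hs).2.2.2.1
  have hsub : closedBall (0 : EuclideanSpace ℝ (Fin n)) (3 / 2 * R) ⊆ ball 0 (2 * R) :=
    closedBall_subset_ball (by linarith)
  have hnorm : ∀ x : EuclideanSpace ℝ (Fin n), ∑ i, x i ^ 2 = ‖x‖ ^ 2 := fun x => by
    rw [EuclideanSpace.norm_sq_eq]; simp
  obtain ⟨F, hF⟩ : ∃ F : EuclideanSpace ℝ (Fin n) → ℝ,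
    F = fun y => ∑ i, pd i w y ^ 2 + l * rexp (b * w y) - K * h (w y) := ⟨_, rfl⟩
  obtain ⟨ψ, hψ⟩ : ∃ ψ : EuclideanSpace ℝ (Fin n) → ℝ,
    ψ = fun y => (r - ∑ i, y i ^ 2) ^ 2 := ⟨_, rfl⟩
  have hψ0 : ∀ y, 0 ≤ ψ y := fun y => by rw [hψ]; positivity
  have hψc : Continuous ψ := by rw [hψ]; fun_prop
  have hFc : ContinuousOn F (closedBall 0 (3 / 2 * R)) := by
    intro y hy
    have hwy := hw y (hsub hy)
    have h1 := hwy.continuousAt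
    have h2 := fun i => (contDiffAt_pd hwy i).continuousAt
    have h3 : ContinuousAt (fun y => h (w y)) y := hcont.continuousAt.comp h1
    have : ContinuousAt F y := by rw [hF]; fun_prop
    exact this.continuousWithinAt
  obtain ⟨x₀, hx₀, hmax⟩ := (isCompact_closedBall (0 : EuclideanSpace ℝ (Fin n))
    (3 / 2 * R)).exists_isMaxOn ⟨0, by simp; positivity⟩ (hψc.continuousOn.mul hFc)
  have hbound : ψ x₀ * F x₀ ≤ M := by
    by_contra! hlt
    have hprod : 0 < ψ x₀ * F x₀ := hM0.trans hlt
    have hψpos : 0 < ψ x₀ := (hψ0 x₀).lt_of_ne fun h0 => by simp [← h0] at hprod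
    have hFpos : 0 < F x₀ := pos_of_mul_pos_right hprod (hψ0 x₀)
    have hnx : ‖x₀‖ ≤ 3 / 2 * R := by simpa using hx₀
    have hφ0 : 0 < r - ∑ i, x₀ i ^ 2 := by
      have h1 : 0 ≤ r - ∑ i, x₀ i ^ 2 := by
        rw [hnorm, hr]
        have : ‖x₀‖ ^ 2 ≤ (3 / 2 * R) ^ 2 := by gcongr
        linarith
      refine h1.lt_of_ne fun h0 => ?_
      rw [hψ] at hψpos
      simp [← h0] at hψpos
    have hint : x₀ ∈ ball (0 : EuclideanSpace ℝ (Fin n)) (3 / 2 * R) := by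
      rw [mem_ball_zero_iff]
      rw [hnorm, hr] at hφ0
      exact lt_of_pow_lt_pow_left₀ 2 (by positivity) (by linarith)
    have hU : x₀ ∈ ball (0 : EuclideanSpace ℝ (Fin n)) (2 * R) := hsub hx₀
    have hwx := hw x₀ hU
    have hpdex : ∀ᶠ y in nhds x₀, ∑ i, pd i (pd i w) y
        = -(∑ i, pd i w y ^ 2) + K * w y - l * rexp (b * w y) :=
      Filter.mem_of_superset (isOpen_ball.mem_nhds hU) hpde
    have hCS := sum_diag_sq_le fun i j => pd i (pd j w) x₀
    have hGx : 0 ≤ ∑ i, pd i w x₀ ^ 2 := Finset.sum_nonneg fun i _ => sq_nonneg _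
    have hEx : 0 < l * rexp (b * w x₀) := by positivity
    have hloc : ∀ k : ℝ → ℝ, (∀ᶠ s in nhds (w x₀), h s ≤ k s) → h (w x₀) = k (w x₀) →
        IsLocalMax (fun y : EuclideanSpace ℝ (Fin n) => (r - ∑ i, y i ^ 2) ^ 2 *
          (∑ i, pd i w y ^ 2 + l * rexp (b * w y) - K * k (w y))) x₀ := by
      intro k hk hk0
      filter_upwards [isOpen_ball.mem_nhds hint, hwx.continuousAt.eventually hk] with y hy hky
      have h1 : ψ y * F y ≤ ψ x₀ * F x₀ := hmax (ball_subset_closedBall hy)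
      simp only [hF, hψ] at h1
      rw [← hk0]
      refine le_trans ?_ h1
      gcongr
    have hfin : ∀ γ₁ γ₂ : ℝ, ∀ k : ℝ, h (w x₀) = k →
        c * F x₀ * (F x₀ + ∑ i, pd i w x₀ ^ 2) ≤ 2 * (∑ i, ∑ j, pd i (pd j w) x₀ ^ 2)
        + 2 * K * (∑ i, pd i w x₀ ^ 2) + b ^ 2 * (l * rexp (b * w x₀)) * (∑ i, pd i w x₀ ^ 2)
        + b * (l * rexp (b * w x₀)) * (∑ i, pd i (pd i w) x₀)
        - K * (γ₂ * (∑ i, pd i w x₀ ^ 2) + γ₁ * (∑ i, pd i (pd i w) x₀))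
        - 2 * K * γ₁ * (∑ i, pd i w x₀ ^ 2) →
        (r - ∑ i, x₀ i ^ 2) ^ 2 * (2 * (∑ i, ∑ j, pd i (pd j w) x₀ ^ 2)
        + 2 * K * (∑ i, pd i w x₀ ^ 2) + b ^ 2 * (l * rexp (b * w x₀)) * (∑ i, pd i w x₀ ^ 2)
        + b * (l * rexp (b * w x₀)) * (∑ i, pd i (pd i w) x₀)
        - K * (γ₂ * (∑ i, pd i w x₀ ^ 2) + γ₁ * (∑ i, pd i (pd i w) x₀))
        - 2 * K * γ₁ * (∑ i, pd i w x₀ ^ 2))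
        ≤ (∑ i, pd i w x₀ ^ 2 + l * rexp (b * w x₀) - K * k) * (24 * (∑ i, x₀ i ^ 2)
        + 4 * n * (r - ∑ i, x₀ i ^ 2)
        + 8 * (r - ∑ i, x₀ i ^ 2) * (∑ i, pd i w x₀ * x₀ i)) → False := by
      intro γ₁ γ₂ k hk hlow hup
      have hFk : F x₀ = ∑ i, pd i w x₀ ^ 2 + l * rexp (b * w x₀) - K * k := by rw [hF, ← hk]
      rw [← hFk] at hup
      have h1 := sq_mul_le_of_bochner hc0 hφ0 hFpos rfl
        ((mul_le_mul_of_nonneg_left hlow (sq_nonneg _)).trans hup)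
      rw [← hM] at h1
      rw [hψ] at hlt
      exact absurd h1 hlt.not_ge
    rcases le_or_gt (w x₀) 0 with hs | hs
    · have hk0 := hneg _ hs
      refine hfin p 0 (p * w x₀) hk0 ?_ (bochner_at_isLocalMax (g := fun s => p * s)
        (g₁ := fun _ => p) hwx hpdex
        (.of_forall fun s => by simpa using (hasDerivAt_id s).const_mul p)
        (hasDerivAt_const _ _) hφ0 (hloc _ (.of_forall hle) hk0))
      have hFx : F x₀ = ∑ i, pd i w x₀ ^ 2 + l * rexp (b * w x₀) - K * (p * w x₀) := by
        rw [hF, ← hk0]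
      refine le_trans ?_ (bochner_lower_bound_of_nonpos hN hp1 hp2 hK hb hEx hGx hCS hs hFx hFpos
        (hpde x₀ hU))
      rw [hc]
      gcongr
    · have hk0 := hpos _ hs
      have hev : ∀ᶠ s in nhds (w x₀), 0 < s := lt_mem_nhds hs
      obtain ⟨-, hd2, h1, h2, h3, h4, h5⟩ := hg _ hs
      refine hfin (g₁ (w x₀)) (g₂ (w x₀)) (g (w x₀)) hk0 ?_ (bochner_at_isLocalMax hwx hpdex
        (hev.mono fun s hs => (hg s hs).1) hd2 hφ0
        (hloc _ (hev.mono fun s hs => (hpos s hs).le) hk0))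
      have hFx : F x₀ = ∑ i, pd i w x₀ ^ 2 + l * rexp (b * w x₀) - K * g (w x₀) := by
        rw [hF, ← hk0]
      rw [hc]
      exact bochner_lower_bound_of_pos hN hδ hδ1 hp2 hK hb hEx hGx hCS hs hFx hFpos
        (hpde x₀ hU) h1 h2 h3 h4 h5
  intro x hx
  have hxn : ‖x‖ < R := by simpa using hx
  have hx1 : x ∈ closedBall (0 : EuclideanSpace ℝ (Fin n)) (3 / 2 * R) := by
    rw [mem_closedBall_zero_iff]; linarith
  have hQ : ψ x * F x ≤ M := (hmax hx1).trans hbound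
  have hφx : 5 / 4 * R ^ 2 ≤ r - ∑ i, x i ^ 2 := by
    rw [hnorm, hr]
    have : ‖x‖ ^ 2 ≤ R ^ 2 := by gcongr
    linarith
  have hψx : (5 / 4 * R ^ 2) ^ 2 ≤ ψ x := by rw [hψ]; beta_reduce; gcongr
  have hFx : F x ≤ M / (5 / 4 * R ^ 2) ^ 2 := by
    rw [le_div_iff₀ (by positivity)]
    rcases le_total (F x) 0 with h0 | h0
    · exact (mul_nonpos_of_nonpos_of_nonneg h0 (by positivity)).trans hM0.le
    · calc F x * (5 / 4 * R ^ 2) ^ 2 ≤ F x * ψ x := by gcongr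
        _ ≤ M := by linarith
  refine le_trans ?_ hFx
  rw [hF]
  have := mul_le_mul_of_nonneg_left (hle (w x)) hK
  linarith

lemma pd_log {u : EuclideanSpace ℝ (Fin n) → ℝ} {x : EuclideanSpace ℝ (Fin n)}
    (hu : ContDiffAt ℝ (⊤ : ℕ∞) u x) (hpos : 0 < u x) (i : Fin n) :
    pd i (fun y => log (u y)) x = pd i u x / u x ∧
    pd i (pd i fun y => log (u y)) x = pd i (pd i u) x / u x - (pd i u x / u x) ^ 2 := by
  have hw := hu.log hpos.ne'
  have hd : ∀ᶠ s in nhds (u x), HasDerivAt log s⁻¹ s :=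
    (lt_mem_nhds hpos).mono fun s hs => hasDerivAt_log hs.ne'
  have hj := (hasJet_line hu i).comp hd (hasDerivAt_inv hpos.ne')
  constructor
  · rw [hj.pd_eq (f := fun y => log (u y)) (hw.differentiableAt (by simp))]
    field_simp
  · rw [hj.pd_pd_eq (f := fun y => log (u y)) hw]
    field_simp; ring

end GradientEstimate

/-- Theorem 1.1, Case 2 (Euclidean case `K = 0`): local gradient estimate for positive
solutions of `Δu + λ₁ u ln u + λ₂ u^(b+1) = 0` with `λ₁ ≤ 0`, `λ₂ > 0`, `b ≤ 0`,
`1 < p < 2`.  The constant depends only on `n`, `R`, `p`. -/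
theorem stmt_1 (n : ℕ) (hn : 1 ≤ n) (R p : ℝ) (hR : 0 < R)
    (hp1 : 1 < p) (hp2 : p < 2) :
    ∃ C : ℝ, 0 < C ∧
      ∀ (lam1 lam2 b : ℝ), lam1 ≤ 0 → 0 < lam2 → b ≤ 0 →
        ∀ u : EuclideanSpace ℝ (Fin n) → ℝ,
          ContDiffOn ℝ (⊤ : ℕ∞) u (ball (0 : EuclideanSpace ℝ (Fin n)) (2 * R)) →
          (∀ x ∈ ball (0 : EuclideanSpace ℝ (Fin n)) (2 * R), 0 < u x) →
          (∀ x ∈ ball (0 : EuclideanSpace ℝ (Fin n)) (2 * R),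
            lap u x + lam1 * u x * Real.log (u x) + lam2 * u x ^ (b + 1) = 0) →
          ∀ x ∈ ball (0 : EuclideanSpace ℝ (Fin n)) R,
            ‖gradient u x‖ ^ 2 / u x ^ 2 + p * lam1 * Real.log (u x) + lam2 * u x ^ b ≤ C := by
  obtain ⟨C, hC, hest⟩ := gradient_estimate_log hn hR hp1 hp2
  refine ⟨C, hC, fun lam1 lam2 b h1 h2 hb u hu hpos hpde x hx => ?_⟩
  have hcd : ∀ y ∈ ball (0 : EuclideanSpace ℝ (Fin n)) (2 * R), ContDiffAt ℝ (⊤ : ℕ∞) u y :=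
    fun y hy => hu.contDiffAt (isOpen_ball.mem_nhds hy)
  have hrpow : ∀ y ∈ ball (0 : EuclideanSpace ℝ (Fin n)) (2 * R),
      rexp (b * log (u y)) = u y ^ b := fun y hy => by
    rw [Real.rpow_def_of_pos (hpos y hy), mul_comm]
  have key := hest (-lam1) lam2 b (by linarith) h2 hb (fun y => log (u y))
    (fun y hy => (hcd y hy).log (hpos y hy).ne') (fun y hy => ?_) x hx
  · have hx2 : x ∈ ball (0 : EuclideanSpace ℝ (Fin n)) (2 * R) :=
      ball_subset_ball (by linarith) hx
    have hsum : ∑ i, pd i (fun y => log (u y)) x ^ 2 = ‖gradient u x‖ ^ 2 / u x ^ 2 := by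
      rw [norm_gradient_sq, Finset.sum_div]
      refine Finset.sum_congr rfl fun i _ => ?_
      rw [(pd_log (hcd x hx2) (hpos x hx2) i).1, div_pow]
    rw [hsum, hrpow x hx2] at key
    linarith
  · have hy0 := hpos y hy
    have hp := hpde y hy
    rw [Real.rpow_add_one hy0.ne', lap_eq_sum_pd] at hp
    have hlog := fun i => pd_log (hcd y hy) hy0 i
    simp only [(hlog _).1, (hlog _).2, Finset.sum_sub_distrib, ← Finset.sum_div]
    have hlap : (∑ i, pd i (pd i u) y) / u y = -lam1 * log (u y) - lam2 * u y ^ b := by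
      rw [div_eq_iff hy0.ne']
      linarith
    rw [hlap, hrpow y hy]
    ring
end

section
/- Fix an integer n ≥ 1. There exists a constant c(n) > 0 depending only on n with the following property. Let h : ℝ → ℝ be C² and let λ ∈ ℝ be such that, for all s ∈ ℝ: (i) −(4/n)(λ−1)h(s) + (λ−2)h'(s) + λ h''(s) ≥ 0; (ii) h(s)·(−(2/n)(λ²−1)h(s) − λ h'(s)) ≥ 0; (iii) λ h(s) ≥ 0. Then for every R > 0, every smooth positive solution u of Δu + u h(ln u) = 0 on the ball B_{2R} ⊂ ℝⁿ satisfies |∇u|²/u² + λ h(ln u) ≤ c(n)/R² and |∇u|/u ≤ √(c(n))/R at every point of B_R. -/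
open Real Metric

/-- The `i`-th partial derivative. -/
noncomputable def partialDeriv {n : ℕ} (i : Fin n) (f : EuclideanSpace ℝ (Fin n) → ℝ) :
    EuclideanSpace ℝ (Fin n) → ℝ :=
  fun x => fderiv ℝ f x (EuclideanSpace.single i 1)

section PartialDeriv

variable {n : ℕ} {i j : Fin n} {f g : EuclideanSpace ℝ (Fin n) → ℝ}
  {x : EuclideanSpace ℝ (Fin n)}

theorem partialDeriv_add (hf : DifferentiableAt ℝ f x) (hg : DifferentiableAt ℝ g x) :
    partialDeriv i (fun y => f y + g y) x = partialDeriv i f x + partialDeriv i g x := by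
  simp [partialDeriv, fderiv_fun_add hf hg]

theorem partialDeriv_mul (hf : DifferentiableAt ℝ f x) (hg : DifferentiableAt ℝ g x) :
    partialDeriv i (fun y => f y * g y) x =
      f x * partialDeriv i g x + g x * partialDeriv i f x := by
  simp [partialDeriv, fderiv_fun_mul hf hg]

theorem partialDeriv_const_mul (c : ℝ) (hf : DifferentiableAt ℝ f x) :
    partialDeriv i (fun y => c * f y) x = c * partialDeriv i f x := by
  simp [partialDeriv, fderiv_const_mul hf]

theorem partialDeriv_sum {ι : Type*} {s : Finset ι} {f : ι → EuclideanSpace ℝ (Fin n) → ℝ}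
    (hf : ∀ k, DifferentiableAt ℝ (f k) x) :
    partialDeriv i (fun y => ∑ k ∈ s, f k y) x = ∑ k ∈ s, partialDeriv i (f k) x := by
  simp [partialDeriv, fderiv_fun_sum (fun k _ => hf k)]

theorem partialDeriv_comp {φ : ℝ → ℝ} (hφ : DifferentiableAt ℝ φ (f x))
    (hf : DifferentiableAt ℝ f x) :
    partialDeriv i (fun y => φ (f y)) x = deriv φ (f x) * partialDeriv i f x := by
  have := (hφ.hasDerivAt.comp_hasFDerivAt x hf.hasFDerivAt).fderiv
  simp only [Function.comp_def] at this
  simp [partialDeriv, this]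

theorem partialDeriv_coord :
    partialDeriv i (fun y => y j) x = if j = i then 1 else 0 := by
  have : HasFDerivAt (fun y : EuclideanSpace ℝ (Fin n) => y j)
      (EuclideanSpace.proj j : EuclideanSpace ℝ (Fin n) →L[ℝ] ℝ) x :=
    (EuclideanSpace.proj j : EuclideanSpace ℝ (Fin n) →L[ℝ] ℝ).hasFDerivAt
  simp [partialDeriv, this.fderiv]

theorem partialDeriv_congr {U : Set (EuclideanSpace ℝ (Fin n))} (hU : IsOpen U)
    (hfg : ∀ y ∈ U, f y = g y) (hx : x ∈ U) : partialDeriv i f x = partialDeriv i g x := by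
  have : f =ᶠ[nhds x] g := Filter.eventually_of_mem (hU.mem_nhds hx) hfg
  simp [partialDeriv, this.fderiv_eq]

theorem ContDiffAt.partialDeriv {m k : WithTop ℕ∞} (hf : ContDiffAt ℝ k f x) (hmk : m + 1 ≤ k) :
    ContDiffAt ℝ m (partialDeriv i f) x :=
  (hf.fderiv_right hmk).clm_apply contDiffAt_const

theorem partialDeriv_comm (hf : ContDiffAt ℝ 2 f x) :
    partialDeriv i (partialDeriv j f) x = partialDeriv j (partialDeriv i f) x := by
  have hd : DifferentiableAt ℝ (fderiv ℝ f) x :=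
    (hf.fderiv_right (m := 1) (by norm_num)).differentiableAt (by norm_num)
  have key : ∀ a b : Fin n, _root_.partialDeriv a (_root_.partialDeriv b f) x =
      fderiv ℝ (fderiv ℝ f) x (EuclideanSpace.single a 1) (EuclideanSpace.single b 1) := by
    intro a b
    have h := (hd.hasFDerivAt.clm_apply
      (hasFDerivAt_const (EuclideanSpace.single b (1 : ℝ)) x)).fderiv
    change fderiv ℝ (fun y => fderiv ℝ f y (EuclideanSpace.single b 1)) x _ = _
    rw [h]
    simp
  rw [key, key]
  exact hf.isSymmSndFDerivAt (by simp) _ _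

theorem partialDeriv_eq_zero_of_isLocalMax (hf : IsLocalMax f x) : partialDeriv i f x = 0 := by
  simp [partialDeriv, hf.fderiv_eq_zero]

theorem deriv_deriv_nonpos_of_isLocalMax {φ : ℝ → ℝ} {t : ℝ} (hφ : IsLocalMax φ t)
    (hc : ContinuousAt φ t) : deriv (deriv φ) t ≤ 0 := by
  by_contra! hpos
  have hmin := isLocalMin_of_deriv_deriv_pos hpos hφ.deriv_eq_zero hc
  have heq : φ =ᶠ[nhds t] fun _ => φ t := by
    filter_upwards [hφ, hmin] with s h1 h2 using le_antisymm h1 h2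
  have := heq.deriv.deriv_eq
  simp at this
  linarith

theorem partialDeriv_partialDeriv_nonpos_of_isLocalMax (hf : ContDiffAt ℝ 2 f x)
    (hmax : IsLocalMax f x) : partialDeriv i (partialDeriv i f) x ≤ 0 := by
  set e : EuclideanSpace ℝ (Fin n) := EuclideanSpace.single i 1 with he
  have hline : ∀ t : ℝ, HasDerivAt (fun s : ℝ => x + s • e) e t := fun t => by
    simpa using ((hasDerivAt_id t).smul_const e).const_add x
  have hcont : Filter.Tendsto (fun s : ℝ => x + s • e) (nhds 0) (nhds x) := by
    have := (hline 0).continuousAt.tendsto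
    simpa using this
  have hmax' : IsLocalMax (fun s : ℝ => f (x + s • e)) 0 := by
    have := hcont.eventually hmax
    simpa [IsLocalMax, IsMaxFilter] using this
  have hC : ContinuousAt (fun s : ℝ => f (x + s • e)) 0 := by
    have h2 : Filter.Tendsto (fun s : ℝ => f (x + s • e)) (nhds 0) (nhds (f x)) :=
      hf.continuousAt.tendsto.comp hcont
    simpa [ContinuousAt] using h2
  have key := deriv_deriv_nonpos_of_isLocalMax hmax' hC
  have hdiff : ∀ᶠ y in nhds x, DifferentiableAt ℝ f y := by
    have := hf.eventually (by simp)
    filter_upwards [this] with y hy using hy.differentiableAt (by norm_num)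
  have h1 : deriv (fun s : ℝ => f (x + s • e)) =ᶠ[nhds 0]
      fun s => partialDeriv i f (x + s • e) := by
    filter_upwards [hcont.eventually hdiff] with s hs
    exact (hs.hasFDerivAt.comp_hasDerivAt s (hline s)).deriv
  have hd : DifferentiableAt ℝ (partialDeriv i f) (x + (0 : ℝ) • e) := by
    have := (hf.partialDeriv (i := i) (m := 1) (by norm_num)).differentiableAt (by norm_num)
    simpa using this
  have h2 := (hd.hasFDerivAt.comp_hasDerivAt (0 : ℝ) (hline 0)).deriv
  rw [h1.deriv_eq] at key
  have h3 : deriv (fun s : ℝ => partialDeriv i f (x + s • e)) 0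
      = fderiv ℝ (partialDeriv i f) x e := by
    simpa [Function.comp_def] using h2
  rw [h3] at key
  exact key

theorem sum_partialDeriv_sq (x : EuclideanSpace ℝ (Fin n)) :
    ∑ i, partialDeriv i f x ^ 2 = ‖gradient f x‖ ^ 2 := by
  rw [EuclideanSpace.real_norm_sq_eq]
  refine Finset.sum_congr rfl fun i _ => ?_
  have h1 : inner ℝ (gradient f x) (EuclideanSpace.single i 1) =
      fderiv ℝ f x (EuclideanSpace.single i 1) := by
    simp [gradient]
  have h2 : partialDeriv i f x = gradient f x i := by
    rw [EuclideanSpace.inner_single_right] at h1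
    simpa [partialDeriv] using h1.symm
  rw [h2]

end PartialDeriv

theorem sq_trace_le_card_mul_sum_sq {n : ℕ} (a : Fin n → Fin n → ℝ) :
    (∑ i, a i i) ^ 2 ≤ n * ∑ j, ∑ i, a j i ^ 2 := by
  have h1 : (∑ i, a i i) ^ 2 ≤ n * ∑ i, a i i ^ 2 := by
    simpa using sq_sum_le_card_mul_sum_sq (s := Finset.univ) (f := fun i => a i i)
  refine h1.trans (mul_le_mul_of_nonneg_left ?_ (Nat.cast_nonneg n))
  refine Finset.sum_le_sum fun j _ => ?_
  exact Finset.single_le_sum (f := fun i => a j i ^ 2) (fun i _ => sq_nonneg _)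
    (Finset.mem_univ j)

/-- The algebraic core of the Bochner argument: `p` stands for `|∇w|²`, `T` for `Δw`,
`S` for `|D²w|²`, and `H`, `H'`, `H''` for the values of `h` and its derivatives. -/
theorem bochner_algebra {N lam p T S H H' H'' : ℝ} (hN : 0 < N) (hp : 0 ≤ p)
    (hT : T + p + H = 0) (hS : T ^ 2 ≤ N * S)
    (h1 : -(4 / N) * (lam - 1) * H + (lam - 2) * H' + lam * H'' ≥ 0)
    (h2 : H * (-(2 / N) * (lam ^ 2 - 1) * H - lam * H') ≥ 0) :
    2 / N * (p + lam * H) ^ 2 ≤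
      2 * S - 2 * H' * p + 2 * lam * H' * p + lam * H'' * p + lam * H' * T := by
  have hT' : T = -p - H := by linarith
  subst hT'
  have hS' : (-p - H) ^ 2 / N ≤ S := by
    rw [div_le_iff₀ hN]; linarith
  have h3 := mul_nonneg h1 hp
  have e : 2 * ((-p - H) ^ 2 / N) - 2 / N * (p + lam * H) ^ 2 =
      (4 / N) * (lam - 1) * (-H) * p + (2 / N) * (1 - lam ^ 2) * H ^ 2 := by
    field_simp; ring
  nlinarith

theorem bochner_inequality {n : ℕ} (hn : 1 ≤ n) {h : ℝ → ℝ} {lam : ℝ} (hh : ContDiff ℝ 2 h)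
    (h1 : ∀ s : ℝ, -(4 / (n : ℝ)) * (lam - 1) * h s + (lam - 2) * deriv h s
            + lam * deriv (deriv h) s ≥ 0)
    (h2 : ∀ s : ℝ, h s * (-(2 / (n : ℝ)) * (lam ^ 2 - 1) * h s - lam * deriv h s) ≥ 0)
    {U : Set (EuclideanSpace ℝ (Fin n))} (hU : IsOpen U) {w : EuclideanSpace ℝ (Fin n) → ℝ}
    (hw : ∀ x ∈ U, ContDiffAt ℝ 3 w x)
    (heq : ∀ x ∈ U, ∑ i, partialDeriv i (partialDeriv i w) x + ∑ i, partialDeriv i w x ^ 2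
      + h (w x) = 0)
    {F : EuclideanSpace ℝ (Fin n) → ℝ}
    (hF : F = fun x => ∑ i, partialDeriv i w x ^ 2 + lam * h (w x))
    {x : EuclideanSpace ℝ (Fin n)} (hx : x ∈ U) :
    2 / n * F x ^ 2 ≤ ∑ j, partialDeriv j (partialDeriv j F) x
      + 2 * ∑ j, partialDeriv j w x * partialDeriv j F x := by
  have hh' : Differentiable ℝ h := hh.differentiable (by norm_num)
  have hh'' : Differentiable ℝ (deriv h) :=
    (hh.iterate_deriv' 1 1).differentiable (by norm_num)
  have w0 : ∀ y ∈ U, DifferentiableAt ℝ w y := fun y hy =>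
    (hw y hy).differentiableAt (by norm_num)
  have w1 : ∀ y ∈ U, ∀ i, DifferentiableAt ℝ (partialDeriv i w) y := fun y hy i =>
    ((hw y hy).partialDeriv (i := i) (m := 2) (by norm_num)).differentiableAt (by norm_num)
  have c1 : ∀ y ∈ U, ∀ i, ContDiffAt ℝ 2 (partialDeriv i w) y := fun y hy i =>
    (hw y hy).partialDeriv (by norm_num)
  have w2 : ∀ y ∈ U, ∀ i j, DifferentiableAt ℝ (partialDeriv j (partialDeriv i w)) y :=
    fun y hy i j => ((c1 y hy i).partialDeriv (i := j) (m := 1) (by norm_num)).differentiableAt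
      (by norm_num)
  have dh : ∀ y ∈ U, DifferentiableAt ℝ (fun z => h (w z)) y := fun y hy =>
    (hh' _).comp y (w0 y hy)
  have dh' : ∀ y ∈ U, DifferentiableAt ℝ (fun z => deriv h (w z)) y := fun y hy =>
    (hh'' _).comp y (w0 y hy)
  have dsq : ∀ y ∈ U, ∀ i, DifferentiableAt ℝ (fun z => partialDeriv i w z ^ 2) y :=
    fun y hy i => (w1 y hy i).pow 2
  have psq : ∀ y ∈ U, ∀ i j, partialDeriv j (fun z => partialDeriv i w z ^ 2) y =
      2 * (partialDeriv i w y * partialDeriv j (partialDeriv i w) y) := by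
    intro y hy i j
    simp only [pow_two]
    rw [partialDeriv_mul (w1 y hy i) (w1 y hy i)]
    ring
  have pF : ∀ j, ∀ y ∈ U, partialDeriv j F y =
      2 * ∑ i, partialDeriv i w y * partialDeriv j (partialDeriv i w) y
        + lam * (deriv h (w y) * partialDeriv j w y) := by
    intro j y hy
    rw [hF, partialDeriv_add (DifferentiableAt.fun_sum fun i _ => dsq y hy i)
        ((dh y hy).const_mul lam),
      partialDeriv_sum (dsq y hy), partialDeriv_const_mul _ (dh y hy),
      partialDeriv_comp (hh' _) (w0 y hy), Finset.mul_sum]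
    simp only [psq y hy]
  have comm3 : ∀ i j, partialDeriv j (partialDeriv j (partialDeriv i w)) x =
      partialDeriv i (partialDeriv j (partialDeriv j w)) x := by
    intro i j
    rw [partialDeriv_congr hU (fun y hy => partialDeriv_comm ((hw y hy).of_le (by norm_num))) hx]
    exact partialDeriv_comm (c1 x hx j)
  have ppF : ∀ j, partialDeriv j (partialDeriv j F) x =
      2 * ∑ i, (partialDeriv i w x * partialDeriv i (partialDeriv j (partialDeriv j w)) x
        + partialDeriv j (partialDeriv i w) x ^ 2)
      + lam * (deriv h (w x) * partialDeriv j (partialDeriv j w) x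
        + partialDeriv j w x * (deriv (deriv h) (w x) * partialDeriv j w x)) := by
    intro j
    have d1 : ∀ i, DifferentiableAt ℝ
        (fun y => partialDeriv i w y * partialDeriv j (partialDeriv i w) y) x :=
      fun i => (w1 x hx i).mul (w2 x hx i j)
    have d2 : DifferentiableAt ℝ (fun y => deriv h (w y) * partialDeriv j w y) x :=
      (dh' x hx).mul (w1 x hx j)
    rw [partialDeriv_congr hU (pF j) hx,
      partialDeriv_add ((DifferentiableAt.fun_sum fun i _ => d1 i).const_mul 2)
        (d2.const_mul lam),
      partialDeriv_const_mul _ (DifferentiableAt.fun_sum fun i _ => d1 i),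
      partialDeriv_sum d1, partialDeriv_const_mul _ d2,
      partialDeriv_mul (dh' x hx) (w1 x hx j), partialDeriv_comp (hh'' _) (w0 x hx)]
    congr 2
    refine Finset.sum_congr rfl fun i _ => ?_
    rw [partialDeriv_mul (w1 x hx i) (w2 x hx i j), comm3]
    ring
  have pE : ∀ i, ∑ j, partialDeriv i (partialDeriv j (partialDeriv j w)) x
      + 2 * ∑ j, partialDeriv j w x * partialDeriv i (partialDeriv j w) x
      + deriv h (w x) * partialDeriv i w x = 0 := by
    intro i
    have hz := partialDeriv_congr (i := i) (g := fun _ => 0) hU heq hx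
    have d3 : DifferentiableAt ℝ (fun y => ∑ j, partialDeriv j (partialDeriv j w) y) x :=
      DifferentiableAt.fun_sum fun j _ => w2 x hx j j
    have d4 : DifferentiableAt ℝ (fun y => ∑ j, partialDeriv j w y ^ 2) x :=
      DifferentiableAt.fun_sum fun j _ => dsq x hx j
    rw [partialDeriv_add (d3.fun_add d4) (dh x hx), partialDeriv_add d3 d4,
      partialDeriv_sum (fun j => w2 x hx j j), partialDeriv_sum (dsq x hx),
      partialDeriv_comp (hh' _) (w0 x hx)] at hz
    simp only [psq x hx, ← Finset.mul_sum] at hz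
    rw [hz]
    simp [partialDeriv]
  have trS := sq_trace_le_card_mul_sum_sq fun j i => partialDeriv j (partialDeriv i w) x
  have hN : (0 : ℝ) < n := by exact_mod_cast hn
  have hp : 0 ≤ ∑ i, partialDeriv i w x ^ 2 := Finset.sum_nonneg fun i _ => sq_nonneg _
  have hFx : F x = ∑ i, partialDeriv i w x ^ 2 + lam * h (w x) := by rw [hF]
  rw [hFx]
  refine (bochner_algebra hN hp (heq x hx) trS (h1 _) (h2 _)).trans (le_of_eq ?_)
  have third : ∑ j, ∑ i, partialDeriv i w x * partialDeriv i (partialDeriv j (partialDeriv j w)) x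
      = - 2 * ∑ i, ∑ j, partialDeriv i w x *
          (partialDeriv j w x * partialDeriv i (partialDeriv j w) x)
        - deriv h (w x) * ∑ i, partialDeriv i w x ^ 2 := by
    rw [Finset.sum_comm]
    simp only [← Finset.mul_sum]
    rw [Finset.mul_sum, Finset.mul_sum, ← Finset.sum_sub_distrib]
    refine Finset.sum_congr rfl fun i _ => ?_
    linear_combination partialDeriv i w x * pE i
  have e1 : ∑ j, partialDeriv j (partialDeriv j F) x =
      2 * ∑ j, ∑ i, partialDeriv i w x * partialDeriv i (partialDeriv j (partialDeriv j w)) x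
      + 2 * ∑ j, ∑ i, partialDeriv j (partialDeriv i w) x ^ 2
      + lam * deriv h (w x) * ∑ j, partialDeriv j (partialDeriv j w) x
      + lam * deriv (deriv h) (w x) * ∑ j, partialDeriv j w x ^ 2 := by
    simp only [ppF, Finset.sum_add_distrib, Finset.mul_sum, mul_add]
    rw [← add_assoc]
    congr 1
    · congr 1
      exact Finset.sum_congr rfl fun j _ => by ring
    · exact Finset.sum_congr rfl fun j _ => by ring
  have e2 : ∑ j, partialDeriv j w x * partialDeriv j F x =
      2 * ∑ j, ∑ i, partialDeriv j w x *
          (partialDeriv i w x * partialDeriv j (partialDeriv i w) x)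
      + lam * deriv h (w x) * ∑ j, partialDeriv j w x ^ 2 := by
    simp only [pF _ x hx, Finset.mul_sum, mul_add, Finset.sum_add_distrib]
    congr 1
    · exact Finset.sum_congr rfl fun j _ => Finset.sum_congr rfl fun i _ => by ring
    · exact Finset.sum_congr rfl fun j _ => by ring
  rw [e1, e2, third]
  ring

/-- The cutoff `ψ = r² - |x|²` and the maximum principle turn a Bochner-type inequality into a
bound for `F`. -/
theorem cutoff_estimate {n : ℕ} (hn : 1 ≤ n) {R : ℝ} (hR : 0 < R)
    {F : EuclideanSpace ℝ (Fin n) → ℝ} {b : Fin n → EuclideanSpace ℝ (Fin n) → ℝ}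
    (hF : ∀ x ∈ ball (0 : EuclideanSpace ℝ (Fin n)) (2 * R), ContDiffAt ℝ 2 F x)
    (hb : ∀ x ∈ ball (0 : EuclideanSpace ℝ (Fin n)) (2 * R), ∑ j, b j x ^ 2 ≤ F x)
    (hineq : ∀ x ∈ ball (0 : EuclideanSpace ℝ (Fin n)) (2 * R),
      2 / n * F x ^ 2 ≤ ∑ j, partialDeriv j (partialDeriv j F) x
        + 2 * ∑ j, b j x * partialDeriv j F x)
    {x : EuclideanSpace ℝ (Fin n)} (hx : x ∈ ball (0 : EuclideanSpace ℝ (Fin n)) R) :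
    F x ≤ (15 * n ^ 2 + 18 * n) / R ^ 2 := by
  have hN : (0 : ℝ) < n := by exact_mod_cast hn
  set ψ : EuclideanSpace ℝ (Fin n) → ℝ := fun y => 3 * R ^ 2 + (-1) * ∑ k, y k * y k with hψ
  have hψn : ∀ y, ψ y = 3 * R ^ 2 - ‖y‖ ^ 2 := by
    intro y
    simp only [hψ, EuclideanSpace.real_norm_sq_eq]
    simp only [pow_two]
    ring
  set K : Set (EuclideanSpace ℝ (Fin n)) := closedBall 0 (Real.sqrt 3 * R) with hK
  have hs3 : Real.sqrt 3 < 2 := by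
    rw [Real.sqrt_lt' (by norm_num)]; norm_num
  have hKU : K ⊆ ball 0 (2 * R) := closedBall_subset_ball (by nlinarith)
  have hs3' : (Real.sqrt 3 * R) ^ 2 = 3 * R ^ 2 := by
    rw [mul_pow, Real.sq_sqrt (by norm_num)]
  have memK : ∀ y, y ∈ K ↔ 0 ≤ ψ y := by
    intro y
    rw [hψn, hK, mem_closedBall_zero_iff, ← hs3', sub_nonneg,
      sq_le_sq₀ (norm_nonneg _) (by positivity)]
  have ψsmooth : ContDiff ℝ 2 ψ := by
    have : ψ = fun y => 3 * R ^ 2 - ‖y‖ ^ 2 := funext hψn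
    rw [this]
    exact contDiff_const.sub (contDiff_norm_sq ℝ)
  set G : EuclideanSpace ℝ (Fin n) → ℝ := fun y => ψ y * ψ y * F y with hG
  have hGc : ContinuousOn G K := fun y hy =>
    ((ψsmooth.continuous.mul ψsmooth.continuous).continuousAt.mul
      (hF y (hKU hy)).continuousAt).continuousWithinAt
  have hnx : ‖x‖ < R := by simpa using hx
  have hψx : 2 * R ^ 2 ≤ ψ x := by
    rw [hψn]; nlinarith [norm_nonneg x]
  have hxK : x ∈ K := (memK x).2 (by nlinarith)
  obtain ⟨z, hzK, hz⟩ := (isCompact_closedBall (0 : EuclideanSpace ℝ (Fin n))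
    (Real.sqrt 3 * R)).exists_isMaxOn ⟨x, hxK⟩ hGc
  have hzU := hKU hzK
  have hF0 : ∀ y ∈ ball (0 : EuclideanSpace ℝ (Fin n)) (2 * R), 0 ≤ F y := fun y hy =>
    (Finset.sum_nonneg fun j _ => sq_nonneg (b j y)).trans (hb y hy)
  suffices hGz : G z ≤ n * (24 + 20 * n) * (3 * R ^ 2) by
    have h1 : G x ≤ G z := hz hxK
    have h2 : (2 * R ^ 2) * (2 * R ^ 2) * F x ≤ G x :=
      mul_le_mul_of_nonneg_right (mul_le_mul hψx hψx (by positivity) (by nlinarith))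
        (hF0 x (hKU hxK))
    rw [le_div_iff₀ (by positivity)]
    have h3 : (0 : ℝ) < 4 * R ^ 2 := by positivity
    refine le_of_mul_le_mul_left ?_ h3
    nlinarith
  have hψz : 0 ≤ ψ z := (memK z).1 hzK
  rcases hψz.eq_or_lt with h0 | hψpos
  · have : G z = 0 := by simp [hG, ← h0]
    rw [this]; positivity
  rcases (hF0 z hzU).eq_or_lt with h0 | hFpos
  · have : G z = 0 := by simp [hG, ← h0]
    rw [this]; positivity
  have hmax : IsLocalMax G z := by
    have : ∀ᶠ y in nhds z, 0 < ψ y :=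
      ψsmooth.continuous.continuousAt.eventually (lt_mem_nhds hψpos)
    filter_upwards [this] with y hy using hz ((memK y).2 hy.le)
  have ψd : ∀ y, DifferentiableAt ℝ ψ y := fun y =>
    (ψsmooth.differentiable (by norm_num)) y
  have cd : ∀ (k : Fin n) y, DifferentiableAt ℝ (fun y : EuclideanSpace ℝ (Fin n) => y k) y :=
    fun k y => (EuclideanSpace.proj k : EuclideanSpace ℝ (Fin n) →L[ℝ] ℝ).differentiableAt
  have pψ : ∀ j y, partialDeriv j ψ y = -2 * y j := by
    intro j y
    rw [hψ, partialDeriv_add (differentiableAt_const _)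
        ((DifferentiableAt.fun_sum fun k _ => (cd k y).fun_mul (cd k y)).const_mul _),
      partialDeriv_const_mul _ (DifferentiableAt.fun_sum fun k _ => (cd k y).fun_mul (cd k y)),
      partialDeriv_sum fun k => (cd k y).fun_mul (cd k y)]
    have : ∀ k, partialDeriv j (fun y : EuclideanSpace ℝ (Fin n) => y k * y k) y =
        if k = j then 2 * y k else 0 := by
      intro k
      rw [partialDeriv_mul (cd k y) (cd k y), partialDeriv_coord]
      split_ifs <;> ring
    simp [this]
    simp [partialDeriv]
  have Fd : ∀ y ∈ ball (0 : EuclideanSpace ℝ (Fin n)) (2 * R), DifferentiableAt ℝ F y :=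
    fun y hy => (hF y hy).differentiableAt (by norm_num)
  have pG : ∀ j, ∀ y ∈ ball (0 : EuclideanSpace ℝ (Fin n)) (2 * R),
      partialDeriv j G y = ψ y * ψ y * partialDeriv j F y + -4 * (F y * (ψ y * y j)) := by
    intro j y hy
    rw [hG, partialDeriv_mul ((ψd y).fun_mul (ψd y)) (Fd y hy), partialDeriv_mul (ψd y) (ψd y), pψ]
    ring
  have ppG : ∀ j, partialDeriv j (partialDeriv j G) z =
      ψ z ^ 2 * partialDeriv j (partialDeriv j F) z - 8 * ψ z * z j * partialDeriv j F z
        + F z * (8 * z j ^ 2 - 4 * ψ z) := by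
    intro j
    have hd : DifferentiableAt ℝ (partialDeriv j F) z :=
      ((hF z hzU).partialDeriv (m := 1) (by norm_num)).differentiableAt (by norm_num)
    have d1 : DifferentiableAt ℝ (fun y : EuclideanSpace ℝ (Fin n) => F y * (ψ y * y j)) z :=
      (Fd z hzU).mul ((ψd z).mul (cd j z))
    rw [partialDeriv_congr isOpen_ball (pG j) hzU,
      partialDeriv_add (((ψd z).fun_mul (ψd z)).fun_mul hd) (d1.const_mul _),
      partialDeriv_const_mul _ d1, partialDeriv_mul ((ψd z).fun_mul (ψd z)) hd,
      partialDeriv_mul (ψd z) (ψd z), partialDeriv_mul (Fd z hzU) ((ψd z).fun_mul (cd j z)),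
      partialDeriv_mul (ψd z) (cd j z), partialDeriv_coord, pψ]
    simp only [if_true]
    ring
  have hG2 : ContDiffAt ℝ 2 G z :=
    (ψsmooth.contDiffAt.mul ψsmooth.contDiffAt).mul (hF z hzU)
  have crit : ∀ j, ψ z * partialDeriv j F z = 4 * F z * z j := by
    intro j
    have h0 := partialDeriv_eq_zero_of_isLocalMax (i := j) hmax
    rw [pG j z hzU] at h0
    refine mul_left_cancel₀ hψpos.ne' ?_
    linear_combination h0
  have hsec : ∀ j, ψ z ^ 2 * partialDeriv j (partialDeriv j F) z ≤
      F z * (24 * z j ^ 2 + 4 * ψ z) := by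
    intro j
    have h0 := partialDeriv_partialDeriv_nonpos_of_isLocalMax (i := j) hG2 hmax
    rw [ppG j] at h0
    have h1 : 8 * ψ z * z j * partialDeriv j F z = 32 * F z * z j ^ 2 := by
      linear_combination 8 * z j * crit j
    linarith
  have hsum : ψ z ^ 2 * ∑ j, partialDeriv j (partialDeriv j F) z ≤
      F z * (24 * ‖z‖ ^ 2 + 4 * n * ψ z) := by
    rw [EuclideanSpace.real_norm_sq_eq, Finset.mul_sum]
    refine (Finset.sum_le_sum fun j _ => hsec j).trans (le_of_eq ?_)
    rw [← Finset.mul_sum, Finset.sum_add_distrib, ← Finset.mul_sum, Finset.sum_const,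
      Finset.card_univ, Fintype.card_fin, nsmul_eq_mul]
    ring
  have hdrift : ψ z ^ 2 * ∑ j, b j z * partialDeriv j F z =
      F z * (4 * ψ z * ∑ j, b j z * z j) := by
    rw [Finset.mul_sum, Finset.mul_sum, Finset.mul_sum]
    refine Finset.sum_congr rfl fun j _ => ?_
    linear_combination ψ z * b j z * crit j
  have hyoung : 8 * ψ z * ∑ j, b j z * z j ≤ 1 / n * G z + 16 * n * ‖z‖ ^ 2 := by
    have h1 : 8 * ψ z * ∑ j, b j z * z j ≤
        1 / n * ψ z ^ 2 * ∑ j, b j z ^ 2 + 16 * n * ∑ j, z j ^ 2 := by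
      simp only [Finset.mul_sum, ← Finset.sum_add_distrib]
      refine Finset.sum_le_sum fun j _ => ?_
      have : 1 / (n : ℝ) * ψ z ^ 2 * b j z ^ 2 + 16 * n * z j ^ 2
          - 8 * ψ z * (b j z * z j) = 1 / n * (ψ z * b j z - 4 * n * z j) ^ 2 := by
        field_simp; ring
      have h0 : 0 ≤ 1 / (n : ℝ) * (ψ z * b j z - 4 * n * z j) ^ 2 := by positivity
      linarith
    rw [EuclideanSpace.real_norm_sq_eq]
    have h2 : 1 / (n : ℝ) * ψ z ^ 2 * ∑ j, b j z ^ 2 ≤ 1 / n * ψ z ^ 2 * F z :=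
      mul_le_mul_of_nonneg_left (hb z hzU) (by positivity)
    have h3 : 1 / (n : ℝ) * G z = 1 / n * ψ z ^ 2 * F z := by
      simp only [hG]; ring
    linarith
  have hmain : F z * (2 / n * G z) ≤
      F z * (24 * ‖z‖ ^ 2 + 4 * n * ψ z + 8 * ψ z * ∑ j, b j z * z j) := by
    have h1 := mul_le_mul_of_nonneg_left (hineq z hzU) (sq_nonneg (ψ z))
    have h2 : F z * (2 / n * G z) = ψ z ^ 2 * (2 / n * F z ^ 2) := by
      simp only [hG]; ring
    rw [h2]
    linarith
  have hmain' := le_of_mul_le_mul_left hmain hFpos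
  have hz2 : ‖z‖ ^ 2 ≤ 3 * R ^ 2 := by have := hψn z; linarith
  have hψ3 : ψ z ≤ 3 * R ^ 2 := by rw [hψn]; nlinarith [norm_nonneg z]
  have hfin : 1 / n * G z ≤ (24 + 20 * n) * (3 * R ^ 2) := by
    have h1 : 2 / (n : ℝ) * G z = 2 * (1 / n * G z) := by ring
    have h2 := mul_le_mul_of_nonneg_left hψ3 hN.le
    have h3 := mul_le_mul_of_nonneg_left hz2 hN.le
    linarith
  have h4 := mul_le_mul_of_nonneg_left hfin hN.le
  have h5 : (n : ℝ) * (1 / n * G z) = G z := by field_simp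
  linarith

/-- Theorem 1.2 (Euclidean case `K = 0`): local gradient estimate for positive solutions of
`Δu + u h(ln u) = 0` under the structural conditions (1.9) on `h` and `λ`. -/
theorem stmt_4 (n : ℕ) (hn : 1 ≤ n) :
    ∃ c : ℝ, 0 < c ∧
      ∀ (h : ℝ → ℝ) (lam : ℝ), ContDiff ℝ 2 h →
        (∀ s : ℝ, -(4 / (n : ℝ)) * (lam - 1) * h s + (lam - 2) * deriv h s
            + lam * deriv (deriv h) s ≥ 0) →
        (∀ s : ℝ, h s * (-(2 / (n : ℝ)) * (lam ^ 2 - 1) * h s - lam * deriv h s) ≥ 0) →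
        (∀ s : ℝ, lam * h s ≥ 0) →
        ∀ R : ℝ, 0 < R →
          ∀ u : EuclideanSpace ℝ (Fin n) → ℝ,
            ContDiffOn ℝ (⊤ : ℕ∞) u (ball (0 : EuclideanSpace ℝ (Fin n)) (2 * R)) →
            (∀ x ∈ ball (0 : EuclideanSpace ℝ (Fin n)) (2 * R), 0 < u x) →
            (∀ x ∈ ball (0 : EuclideanSpace ℝ (Fin n)) (2 * R),
              lap u x + u x * h (Real.log (u x)) = 0) →
            ∀ x ∈ ball (0 : EuclideanSpace ℝ (Fin n)) R,
              ‖gradient u x‖ ^ 2 / u x ^ 2 + lam * h (Real.log (u x)) ≤ c / R ^ 2 ∧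
              ‖gradient u x‖ / u x ≤ Real.sqrt c / R := by
  have hN : (1 : ℝ) ≤ n := by exact_mod_cast hn
  have hc : (0 : ℝ) < 15 * n ^ 2 + 18 * n := by positivity
  refine ⟨15 * n ^ 2 + 18 * n, hc, ?_⟩
  intro h lam hh h1 h2 h3 R hR u hu hpos heq x hx
  set U := ball (0 : EuclideanSpace ℝ (Fin n)) (2 * R) with hU
  have hUo : IsOpen U := isOpen_ball
  have hxU : x ∈ U := ball_subset_ball (by linarith) hx
  have cu : ∀ y ∈ U, ContDiffAt ℝ 3 u y := fun y hy =>
    (hu.contDiffAt (hUo.mem_nhds hy)).of_le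
      (WithTop.coe_le_coe.2 (le_top : (3 : ℕ∞) ≤ ⊤))
  set w : EuclideanSpace ℝ (Fin n) → ℝ := fun y => Real.log (u y) with hw
  have cw : ∀ y ∈ U, ContDiffAt ℝ 3 w y := fun y hy => (cu y hy).log (hpos y hy).ne'
  have du : ∀ y ∈ U, DifferentiableAt ℝ u y := fun y hy =>
    (cu y hy).differentiableAt (by norm_num)
  have dw : ∀ y ∈ U, ∀ i, DifferentiableAt ℝ (partialDeriv i w) y := fun y hy i =>
    ((cw y hy).partialDeriv (m := 1) (by norm_num)).differentiableAt (by norm_num)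
  have pw : ∀ i, ∀ y ∈ U, partialDeriv i w y = (u y)⁻¹ * partialDeriv i u y := by
    intro i y hy
    rw [hw, partialDeriv_comp (Real.differentiableAt_log (hpos y hy).ne') (du y hy),
      Real.deriv_log]
  have ppu : ∀ i, ∀ y ∈ U, partialDeriv i (partialDeriv i u) y =
      u y * (partialDeriv i (partialDeriv i w) y + partialDeriv i w y ^ 2) := by
    intro i y hy
    have hpu : ∀ z ∈ U, partialDeriv i u z = u z * partialDeriv i w z := by
      intro z hz
      rw [pw i z hz, mul_inv_cancel_left₀ (hpos z hz).ne']
    rw [partialDeriv_congr hUo hpu hy, partialDeriv_mul (du y hy) (dw y hy i), hpu y hy]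
    ring
  have weq : ∀ y ∈ U, ∑ i, partialDeriv i (partialDeriv i w) y + ∑ i, partialDeriv i w y ^ 2
      + h (w y) = 0 := by
    intro y hy
    have h0 : ∑ i, partialDeriv i (partialDeriv i u) y + u y * h (w y) = 0 := heq y hy
    rw [Finset.sum_congr rfl fun i _ => ppu i y hy, ← Finset.mul_sum, ← mul_add,
      Finset.sum_add_distrib] at h0
    exact (mul_eq_zero.1 h0).resolve_left (hpos y hy).ne'
  have grad : ∑ i, partialDeriv i w x ^ 2 = ‖gradient u x‖ ^ 2 / u x ^ 2 := by
    rw [← sum_partialDeriv_sq, Finset.sum_div]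
    refine Finset.sum_congr rfl fun i _ => ?_
    rw [pw i x hxU]
    field_simp
  have key := cutoff_estimate hn hR
    (F := fun y => ∑ i, partialDeriv i w y ^ 2 + lam * h (w y)) (b := fun i => partialDeriv i w)
    (fun y hy => (ContDiffAt.sum fun i _ =>
      ((cw y hy).partialDeriv (m := 2) (by norm_num)).pow 2).add
      (contDiffAt_const.mul (hh.contDiffAt.comp y ((cw y hy).of_le (by norm_num)))))
    (fun y _ => by have := h3 (w y); linarith)
    (fun y hy => bochner_inequality hn hh h1 h2 hUo cw weq rfl hy) hx
  simp only [grad] at key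
  refine ⟨key, ?_⟩
  have hle : (‖gradient u x‖ / u x) ^ 2 ≤ (15 * n ^ 2 + 18 * n) / R ^ 2 := by
    rw [div_pow]
    have := h3 (w x)
    linarith
  have := Real.le_sqrt_of_sq_le hle
  rwa [Real.sqrt_div hc.le, Real.sqrt_sq hR.le] at this
end
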